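/- arXiv:2301.00633 — 6 statements merged into one kernel-verified Lean document; each statement's English description precedes it below -/
import Mathlib

section
/- For every integer n ≥ 2 that is a power of 2, there exists a nested (n,n,n,n)-perfect toroidal array over 𝔽₂ (of size n·2^{n²/2} × n·2^{n²/2}). -/
/-- Entries of the Pascal-triangle matrix `M_d` (block recursive definition),
indexed by natural numbers. -/
def MdEnt : ℕ → ℕ → ℕ → ZMod 2
  | 0, _, _ => 1
  | d+1, i, j =>
    if i < 2 ^ d then
      if j < 2 ^ d then MdEnt d i j else MdEnt d i (j - 2 ^ d)
    else
      if j < 2 ^ d then 0 else MdEnt d (i - 2 ^ d) (j - 2 ^ d)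

/-- The matrix `M_d` over `𝔽₂`: `M_0 = (1)` and `M_{d+1} = [[M_d, M_d],[0, M_d]]`. -/
def Md (d : ℕ) : Matrix (Fin (2 ^ d)) (Fin (2 ^ d)) (ZMod 2) :=
  Matrix.of fun i j => MdEnt d (i : ℕ) (j : ℕ)

/-- The `s × t` array `P` occurs at position `(k, l)` in the toroidal array `A`. -/
def Occurs {N s t : ℕ} (A : ZMod N → ZMod N → ZMod 2)
    (P : Fin s → Fin t → ZMod 2) (k l : ZMod N) : Prop :=
  ∀ (i : Fin s) (j : Fin t), A (k + ((i : ℕ) : ZMod N)) (l + ((j : ℕ) : ZMod N)) = P i j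

/-- The toroidal array `A` of size `N × N` is `(s,t,p,q)`-perfect. -/
def IsPerfect (N s t p q : ℕ) (A : ZMod N → ZMod N → ZMod 2) : Prop :=
  ∀ (P : Fin s → Fin t → ZMod 2) (a b : ℕ), a < p → b < q →
    ∃! kl : Fin N × Fin N,
      (kl.1 : ℕ) % p = a ∧ (kl.2 : ℕ) % q = b ∧
        Occurs A P (((kl.1 : ℕ) : ZMod N)) (((kl.2 : ℕ) : ZMod N))

/-- `B` is an aligned subarray of `A` of size `L × L` (where `L` divides `N`). -/
def IsAlignedSub (N L : ℕ) (A : ZMod N → ZMod N → ZMod 2)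
    (B : ZMod L → ZMod L → ZMod 2) : Prop :=
  ∃ p q : ℕ, p < N / L ∧ q < N / L ∧
    ∀ (x y : Fin L),
      B ((x : ℕ) : ZMod L) ((y : ℕ) : ZMod L) =
        A (((p * L + (x : ℕ) : ℕ) : ZMod N)) (((q * L + (y : ℕ) : ℕ) : ZMod N))

/-- Nestedness of an `(n,n,n,n)`-perfect toroidal array of size
`n·2^{n²/2} × n·2^{n²/2}`. -/
def IsNested (n : ℕ)
    (A : ZMod (n * 2 ^ (n ^ 2 / 2)) → ZMod (n * 2 ^ (n ^ 2 / 2)) → ZMod 2) : Prop :=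
  ∀ k, 1 ≤ k → k ≤ n →
    ∀ B : ZMod (n * 2 ^ (n * k / 2)) → ZMod (n * 2 ^ (n * k / 2)) → ZMod 2,
      IsAlignedSub (n * 2 ^ (n ^ 2 / 2)) (n * 2 ^ (n * k / 2)) A B →
        IsPerfect (n * 2 ^ (n * k / 2)) k n n n B

/-- A nested `(n,n,n,n)`-perfect toroidal array. -/
def IsNestedPerfect (n : ℕ)
    (A : ZMod (n * 2 ^ (n ^ 2 / 2)) → ZMod (n * 2 ^ (n ^ 2 / 2)) → ZMod 2) : Prop :=
  IsPerfect (n * 2 ^ (n ^ 2 / 2)) n n n n A ∧ IsNested n A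

/-- `σ`: rotate a column vector downward by one step,
`(a_1,…,a_n) ↦ (a_n,a_1,…,a_{n-1})`. -/
def sigmaStep {n : ℕ} [NeZero n] (C : Fin n → ZMod 2) : Fin n → ZMod 2 :=
  fun i => C (i - 1)

instance instNeZeroTwoPow (d : ℕ) : NeZero (2 ^ d) := ⟨(Nat.two_pow_pos d).ne'⟩

/-- Admissibility of a sequence of rotation amounts `m_0,…,m_{n-1}`:
`m_{n-1} = 0` and `m_{i+1} ≤ m_i ≤ m_{i+1} + 1`. -/
def Admissible {n : ℕ} (m : Fin n → ℕ) : Prop :=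
  (∀ i : Fin n, (i : ℕ) = n - 1 → m i = 0) ∧
  ∀ i j : Fin n, (j : ℕ) = (i : ℕ) + 1 → m j ≤ m i ∧ m i ≤ m j + 1

/-- The Pascal-like matrix `M_d^{m_0,…,m_{n-1}}`: column `j` of `M_d`
rotated by `σ^{m_j}`. -/
def pascalLike (d : ℕ) (m : Fin (2 ^ d) → ℕ) :
    Matrix (Fin (2 ^ d)) (Fin (2 ^ d)) (ZMod 2) :=
  Matrix.of fun i j => (sigmaStep^[m j] (fun r => Md d r j)) i

/-- `M_{i,j}` lies in the upper border of `M`: it is the topmost `1` of its column. -/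
def UpperBorder {n : ℕ} (M : Matrix (Fin n) (Fin n) (ZMod 2)) (i j : Fin n) : Prop :=
  M i j = 1 ∧ ∀ r : Fin n, r < i → M r j = 0

/-- The enumeration `N_k` of all `n × n` matrices over `𝔽₂`:
entry `(i,j)` of `N_k` is the binary digit of `k` at position `n²−1−(i·n+j)`. -/
def Nmat (n k : ℕ) : Matrix (Fin n) (Fin n) (ZMod 2) :=
  Matrix.of fun i j =>
    if Nat.testBit k (n ^ 2 - 1 - ((i : ℕ) * n + (j : ℕ))) then 1 else 0

/-- The integer whose binary digit at position `t` is the digit of `k` at position `2t`. -/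
def evenPart (k : ℕ) : ℕ :=
  ∑ t ∈ Finset.range k, if Nat.testBit k (2 * t) then 2 ^ t else 0

/-- The integer whose binary digit at position `t` is the digit of `k` at position `2t+1`. -/
def oddPart (k : ℕ) : ℕ :=
  ∑ t ∈ Finset.range k, if Nat.testBit k (2 * t + 1) then 2 ^ t else 0

/-- The integer whose odd-position binary digits are those of `l` and whose
even-position binary digits are those of `m`; inverse of `k ↦ (oddPart k, evenPart k)`. -/
def joinOE (l m : ℕ) : ℕ :=
  ∑ t ∈ Finset.range (l + m + 1),
    ((if Nat.testBit l t then 2 ^ (2 * t + 1) else 0) +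
      (if Nat.testBit m t then 2 ^ (2 * t) else 0))

/-- The Pascal toroidal array `A_d` of size `n·2^{n²/2} × n·2^{n²/2}` (`n = 2^d`):
the matrix `M_d·N_k` is placed with upper left corner at `(odd(k)·n, even(k)·n)`. -/
def pascalArray (d : ℕ) :
    ZMod (2 ^ d * 2 ^ ((2 ^ d) ^ 2 / 2)) → ZMod (2 ^ d * 2 ^ ((2 ^ d) ^ 2 / 2)) → ZMod 2 :=
  fun x y =>
    (Md d * Nmat (2 ^ d) (joinOE (x.val / 2 ^ d) (y.val / 2 ^ d)))
      ⟨x.val % 2 ^ d, Nat.mod_lt _ (Nat.two_pow_pos d)⟩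
      ⟨y.val % 2 ^ d, Nat.mod_lt _ (Nat.two_pow_pos d)⟩

/-- The `(n,n,n,n)`-affine toroidal array determined by the Pascal-like matrix
given by rotations `m` and the matrix `Z`: the matrix `M·N_k ⊕ Z` is placed with
upper left corner at `(odd(k)·n, even(k)·n)`. -/
def affineArray (d : ℕ) (m : Fin (2 ^ d) → ℕ)
    (Z : Matrix (Fin (2 ^ d)) (Fin (2 ^ d)) (ZMod 2)) :
    ZMod (2 ^ d * 2 ^ ((2 ^ d) ^ 2 / 2)) → ZMod (2 ^ d * 2 ^ ((2 ^ d) ^ 2 / 2)) → ZMod 2 :=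
  fun x y =>
    (pascalLike d m * Nmat (2 ^ d) (joinOE (x.val / 2 ^ d) (y.val / 2 ^ d)) + Z)
      ⟨x.val % 2 ^ d, Nat.mod_lt _ (Nat.two_pow_pos d)⟩
      ⟨y.val % 2 ^ d, Nat.mod_lt _ (Nat.two_pow_pos d)⟩

namespace NestedAux

/-- periodic Pascal columns, in reversed order -/
def cf (n r i : ℕ) : ZMod 2 := ((Nat.choose (n - 1 - r) (i % n) : ℕ) : ZMod 2)

/-- binary digit -/
def bt (Y t : ℕ) : ZMod 2 := ((Y / 2 ^ t : ℕ) : ZMod 2)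

theorem choose_pred (d i : ℕ) (hi : i < 2 ^ d) :
    ((Nat.choose (2 ^ d - 1) i : ℕ) : ZMod 2) = 1 := by
  induction i with
  | zero => simp
  | succ i ih =>
    have h1 := ih (by omega)
    have h2 : 2 ∣ Nat.choose (2 ^ d) (i + 1) :=
      Nat.Prime.dvd_choose_pow Nat.prime_two (by omega) (by omega)
    have h3 : Nat.choose (2 ^ d) (i + 1) =
        Nat.choose (2 ^ d - 1) i + Nat.choose (2 ^ d - 1) (i + 1) := by
      conv_lhs => rw [show 2 ^ d = (2 ^ d - 1) + 1 by omega]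
      exact Nat.choose_succ_succ _ _
    have h4 : ((Nat.choose (2 ^ d) (i + 1) : ℕ) : ZMod 2) = 0 :=
      (ZMod.natCast_eq_zero_iff _ _).2 h2
    rw [h3, Nat.cast_add, h1] at h4
    generalize ((Nat.choose (2 ^ d - 1) (i + 1) : ℕ) : ZMod 2) = z at *
    revert z
    decide

theorem cf_zero (n d i : ℕ) (hnd : n = 2 ^ d) : cf n 0 i = 1 := by
  subst hnd
  exact choose_pred d _ (Nat.mod_lt _ (Nat.two_pow_pos d))

theorem cf_succ (n r i : ℕ) (hr : r + 1 < n) :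
    cf n (r + 1) i + cf n (r + 1) (i + 1) = cf n r (i + 1) := by
  unfold cf
  obtain ⟨m, hm⟩ : ∃ m, n - 1 - (r + 1) = m := ⟨_, rfl⟩
  have hm' : n - 1 - r = m + 1 := by omega
  have hlt : i % n < n := Nat.mod_lt _ (by omega)
  rw [hm, hm', ← Nat.cast_add]
  by_cases h : i % n + 1 < n
  · have : (i + 1) % n = i % n + 1 := by
      rw [Nat.add_mod, Nat.mod_eq_of_lt (show 1 < n by omega), Nat.mod_eq_of_lt h]
    rw [this, Nat.choose_succ_succ]
  · have h0 : i % n = n - 1 := by omega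
    have : (i + 1) % n = 0 := by
      rw [Nat.add_mod, Nat.mod_eq_of_lt (show 1 < n by omega), h0,
        show n - 1 + 1 = n by omega, Nat.mod_self]
    rw [this, h0, Nat.choose_eq_zero_of_lt (show m < n - 1 by omega)]
    simp

theorem cf_tri (n r i : ℕ) (h : n - 1 - r < i) (hi : i < n) : cf n r i = 0 := by
  unfold cf
  rw [Nat.mod_eq_of_lt hi, Nat.choose_eq_zero_of_lt h]
  simp

theorem cf_inj (n d : ℕ) (hnd : n = 2 ^ d) (k : ℕ) : ∀ (_ : k ≤ n) (a : ℕ) (D : ℕ → ZMod 2),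
    (∀ i < k, ∑ r ∈ Finset.range k, cf n r (a + i) * D r = 0) → ∀ r < k, D r = 0 := by
  induction k with
  | zero => intro _ a D _ r hr; omega
  | succ k ih =>
    intro hk a D h
    have h1 : ∀ r < k, D (r + 1) = 0 := by
      apply ih (by omega) (a + 1) (fun r => D (r + 1))
      intro i hi
      have e1 := h i (by omega)
      have e2 := h (i + 1) (by omega)
      have e3 : ∑ r ∈ Finset.range (k + 1),
          (cf n r (a + i) + cf n r (a + (i + 1))) * D r = 0 := by
        simp only [add_mul, Finset.sum_add_distrib, e1, e2, add_zero]
      rw [Finset.sum_range_succ'] at e3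
      rw [cf_zero n d _ hnd, cf_zero n d _ hnd, show (1 + 1 : ZMod 2) = 0 by decide, zero_mul,
        add_zero] at e3
      rw [← e3]
      apply Finset.sum_congr rfl
      intro r hr
      have hr' := Finset.mem_range.1 hr
      rw [← add_assoc a i 1, cf_succ n r (a + i) (by omega)]
      congr 2
      omega
    have h0 := h 0 (by omega)
    rw [Finset.sum_range_succ', cf_zero n d _ hnd, Finset.sum_eq_zero] at h0
    · intro r hr
      rcases r with _ | r
      · simpa using h0
      · exact h1 r (by omega)
    · intro r hr
      simp [h1 r (Finset.mem_range.1 hr)]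

theorem bt_step (Y Y' t : ℕ) (h : Y % 2 ^ t = Y' % 2 ^ t) (hb : bt Y t = bt Y' t) :
    Y % 2 ^ (t + 1) = Y' % 2 ^ (t + 1) := by
  unfold bt at hb
  rw [ZMod.natCast_eq_natCast_iff'] at hb
  rw [Nat.mod_pow_succ, Nat.mod_pow_succ, h, hb]

theorem bt_mod (Y T t : ℕ) (h : t < T) : bt (Y % 2 ^ T) t = bt Y t := by
  unfold bt
  rw [ZMod.natCast_eq_natCast_iff']
  have h1 := Nat.testBit_mod_two_pow Y T t
  simp only [Nat.testBit_eq_decide_div_mod_eq, h, decide_true, Bool.true_and,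
    decide_eq_decide] at h1
  omega

theorem bits_inj (Y Y' : ℕ) (e : ℕ → ℕ) (T : ℕ)
    (h : ∀ t < T, bt (Y + e t) t = bt (Y' + e t) t) : Y % 2 ^ T = Y' % 2 ^ T := by
  induction T with
  | zero => simp [Nat.mod_one]
  | succ T ih =>
    have h1 : Y ≡ Y' [MOD 2 ^ T] := ih (fun t ht => h t (by omega))
    have h2 := bt_step _ _ T (h1.add_right (e T)) (h T (by omega))
    exact Nat.ModEq.add_right_cancel' (e T) h2

/-- the local formula -/
def Form (n h k : ℕ) (C : ℕ → ℕ → ZMod 2) (x y : ℕ) : ZMod 2 :=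
  ∑ r ∈ Finset.range k, cf n r x *
    bt (if (y % n) % 2 = 0 then x / n else y / n) (r * h + (y % n) / 2) + C (x % n) (y % n)

theorem exists_shift (n b m : ℕ) (hb : b < n) (hm : m < n) :
    ∃ j < n, (b + j) % n = m ∧ (b + j) / n = if m < b then 1 else 0 := by
  by_cases h : m < b
  · refine ⟨m + n - b, by omega, ?_, ?_⟩
    · rw [show b + (m + n - b) = m + n by omega]; simp [Nat.mod_eq_of_lt hm]
    · rw [show b + (m + n - b) = m + n by omega, if_pos h, Nat.add_div_right _ (by omega),
        Nat.div_eq_of_lt hm]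
  · refine ⟨m - b, by omega, ?_, ?_⟩
    · rw [show b + (m - b) = m by omega]; exact Nat.mod_eq_of_lt hm
    · rw [show b + (m - b) = m by omega, if_neg h, Nat.div_eq_of_lt hm]

theorem cf_add_mul (n r X i : ℕ) : cf n r (n * X + i) = cf n r i := by
  unfold cf; simp

theorem form_even (n h k : ℕ) (C : ℕ → ℕ → ZMod 2) (X i Y j m : ℕ) (hn : 0 < n)
    (hm : j % n = m) (he : m % 2 = 0) :
    Form n h k C (n * X + i) (n * Y + j) =
      ∑ r ∈ Finset.range k, cf n r i * bt (X + i / n) (r * h + m / 2) + C (i % n) m := by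
  unfold Form
  simp only [Nat.mul_add_mod, hm, he, if_true, Nat.mul_add_div hn, cf_add_mul]

theorem form_odd (n h k : ℕ) (C : ℕ → ℕ → ZMod 2) (X i Y j m : ℕ) (hn : 0 < n)
    (hm : j % n = m) (he : m % 2 = 1) :
    Form n h k C (n * X + i) (n * Y + j) =
      ∑ r ∈ Finset.range k, cf n r i * bt (Y + j / n) (r * h + m / 2) + C (i % n) m := by
  unfold Form
  simp only [Nat.mul_add_mod, hm, he, Nat.mul_add_div hn, cf_add_mul, one_ne_zero, if_false]

theorem div_lt_of (h k t : ℕ) (ht : t < h * k) : t / h < k := Nat.div_lt_of_lt_mul ht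

theorem inj_Y (n d h k : ℕ) (hnd : n = 2 ^ d) (hh : n = 2 * h) (hk : k ≤ n)
    (C : ℕ → ℕ → ZMod 2) (a b X Y X' Y' : ℕ) (hb : b < n) (hn : 0 < n)
    (H : ∀ i < k, ∀ j < n, Form n h k C (n * X + (a + i)) (n * Y + (b + j)) =
      Form n h k C (n * X' + (a + i)) (n * Y' + (b + j))) :
    Y % 2 ^ (h * k) = Y' % 2 ^ (h * k) := by
  apply bits_inj Y Y' (fun t => if 2 * (t % h) + 1 < b then 1 else 0)
  intro t ht
  have hth : t % h < h := Nat.mod_lt _ (by omega)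
  obtain ⟨j, hj, h1, h2⟩ := exists_shift n b (2 * (t % h) + 1) hb (by omega)
  have key := cf_inj n d hnd k hk a
    (fun r => bt (Y + (b + j) / n) (r * h + (2 * (t % h) + 1) / 2) -
      bt (Y' + (b + j) / n) (r * h + (2 * (t % h) + 1) / 2)) ?_ (t / h) (div_lt_of h k t ht)
  · rw [show (2 * (t % h) + 1) / 2 = t % h by omega, Nat.div_add_mod', h2] at key
    exact sub_eq_zero.1 key
  · intro i hi
    have e := H i hi j hj
    rw [form_odd n h k C X _ Y _ _ hn h1 (by omega),
      form_odd n h k C X' _ Y' _ _ hn h1 (by omega)] at e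
    simp only [mul_sub, Finset.sum_sub_distrib]
    exact sub_eq_zero.2 (add_right_cancel e)

theorem inj_X (n d h k : ℕ) (hnd : n = 2 ^ d) (hh : n = 2 * h) (hk : k ≤ n)
    (C : ℕ → ℕ → ZMod 2) (a b X Y X' Y' : ℕ) (ha : a < n) (hb : b < n) (hn : 0 < n)
    (H : ∀ i < k, ∀ j < n, Form n h k C (n * X + (a + i)) (n * Y + (b + j)) =
      Form n h k C (n * X' + (a + i)) (n * Y' + (b + j))) :
    X % 2 ^ (h * k) = X' % 2 ^ (h * k) := by
  have E : ∀ s < h, ∀ i < k, ∑ r ∈ Finset.range k, cf n r (a + i) *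
      (bt (X + (a + i) / n) (r * h + s) - bt (X' + (a + i) / n) (r * h + s)) = 0 := by
    intro s hs i hi
    obtain ⟨j, hj, h1, h2⟩ := exists_shift n b (2 * s) hb (by omega)
    have e := H i hi j hj
    rw [form_even n h k C X _ Y _ _ hn h1 (by omega),
      form_even n h k C X' _ Y' _ _ hn h1 (by omega), show 2 * s / 2 = s by omega] at e
    simp only [mul_sub, Finset.sum_sub_distrib]
    exact sub_eq_zero.2 (add_right_cancel e)
  have hpos : 0 < h := by omega
  by_cases hc : a + k ≤ n
  · apply bits_inj X X' (fun _ => 0)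
    intro t ht
    have key := cf_inj n d hnd k hk a
      (fun r => bt X (r * h + t % h) - bt X' (r * h + t % h)) ?_ (t / h) (div_lt_of h k t ht)
    · rw [Nat.div_add_mod'] at key
      exact sub_eq_zero.1 key
    · intro i hi
      have e := E (t % h) (Nat.mod_lt _ hpos) i hi
      rw [Nat.div_eq_of_lt (show a + i < n by omega)] at e
      exact e
  · obtain ⟨e, he⟩ : ∃ e, e = n - a := ⟨_, rfl⟩
    have tri : ∀ i < e, ∀ r, e ≤ r → cf n r (a + i) = 0 := by
      intro i hi r hr
      exact cf_tri n r (a + i) (by omega) (by omega)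
    have low : X ≡ X' [MOD 2 ^ (h * e)] := by
      apply bits_inj X X' (fun _ => 0)
      intro t ht
      have key := cf_inj n d hnd e (by omega) a
        (fun r => bt X (r * h + t % h) - bt X' (r * h + t % h)) ?_ (t / h) (div_lt_of h e t ht)
      · rw [Nat.div_add_mod'] at key
        exact sub_eq_zero.1 key
      · intro i hi
        have e1 := E (t % h) (Nat.mod_lt _ hpos) i (by omega)
        rw [Nat.div_eq_of_lt (show a + i < n by omega)] at e1
        rw [← e1]
        apply Finset.sum_subset
        · intro r hr
          simp only [Finset.mem_range] at hr ⊢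
          omega
        · intro r _ hr
          simp only [Finset.mem_range, not_lt] at hr
          rw [tri i hi r hr, zero_mul]
    have low1 : ∀ t < h * e, bt (X + 1) t = bt (X' + 1) t := by
      intro t ht
      rw [← bt_mod (X + 1) (h * e) t ht, ← bt_mod (X' + 1) (h * e) t ht,
        show (X + 1) % 2 ^ (h * e) = (X' + 1) % 2 ^ (h * e) from low.add_right 1]
    apply bits_inj X X' (fun _ => 1)
    intro t ht
    have hth : t % h < h := Nat.mod_lt _ hpos
    have key := cf_inj n d hnd k hk a
      (fun r => bt (X + 1) (r * h + t % h) - bt (X' + 1) (r * h + t % h)) ?_ (t / h)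
      (div_lt_of h k t ht)
    · rw [Nat.div_add_mod'] at key
      exact sub_eq_zero.1 key
    · intro i hi
      by_cases hie : i < e
      · apply Finset.sum_eq_zero
        intro r _
        by_cases hre : r < e
        · rw [low1 (r * h + t % h) (by nlinarith), sub_self, mul_zero]
        · rw [tri i hie r (by omega), zero_mul]
      · have e1 := E (t % h) hth i hi
        rw [show (a + i) / n = 1 by
          rw [Nat.div_eq_iff (by omega)]; omega] at e1
        exact e1

theorem core (n d h k L : ℕ) (hnd : n = 2 ^ d) (hh : n = 2 * h) (hk : k ≤ n) (hn : 0 < n)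
    (hL : L = n * 2 ^ (h * k)) (C : ℕ → ℕ → ZMod 2) (B : ZMod L → ZMod L → ZMod 2)
    (hB : ∀ x y : ℕ, x < L → y < L → B (x : ZMod L) (y : ZMod L) = Form n h k C x y) :
    IsPerfect L k n n n B := by
  have hLpos : 0 < L := by rw [hL]; positivity
  have hper : ∀ x y : ℕ, Form n h k C (x % L) (y % L) = Form n h k C x y := by
    intro x y
    have m1 : ∀ x : ℕ, x % L % n = x % n := by
      intro x; exact Nat.mod_mod_of_dvd _ ⟨_, hL⟩
    have d1 : ∀ x : ℕ, x % L / n = x / n % 2 ^ (h * k) := by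
      intro x; rw [hL]; exact Nat.mod_mul_right_div_self _ _ _
    unfold Form
    rw [m1, m1, d1, d1]
    congr 1
    apply Finset.sum_congr rfl
    intro r hr
    have hr' := Finset.mem_range.1 hr
    have hyn : y % n < n := Nat.mod_lt _ hn
    have ht : r * h + y % n / 2 < h * k := by
      have : y % n / 2 < h := by omega
      nlinarith
    congr 1
    · unfold cf; rw [m1]
    · rw [← bt_mod (if y % n % 2 = 0 then x / n else y / n) (h * k) _ ht]
      split_ifs <;> rfl
  have hB' : ∀ x y : ℕ, B (x : ZMod L) (y : ZMod L) = Form n h k C x y := by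
    intro x y
    rw [← hper, ← hB _ _ (Nat.mod_lt _ hLpos) (Nat.mod_lt _ hLpos)]
    simp
  intro P a b ha hb
  let Φ : Fin (2 ^ (h * k)) × Fin (2 ^ (h * k)) → (Fin k → Fin n → ZMod 2) :=
    fun p i j => Form n h k C (n * (p.1 : ℕ) + (a + i)) (n * (p.2 : ℕ) + (b + j))
  have hinj : Function.Injective Φ := by
    rintro ⟨X, Y⟩ ⟨X', Y'⟩ hE
    have H : ∀ i < k, ∀ j < n, Form n h k C (n * (X : ℕ) + (a + i)) (n * (Y : ℕ) + (b + j)) =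
      Form n h k C (n * (X' : ℕ) + (a + i)) (n * (Y' : ℕ) + (b + j)) := by
      intro i hi j hj
      exact congrFun (congrFun hE ⟨i, hi⟩) ⟨j, hj⟩
    have h1 := inj_X n d h k hnd hh hk C a b X Y X' Y' ha hb hn H
    have h2 := inj_Y n d h k hnd hh hk C a b X Y X' Y' hb hn H
    rw [Nat.mod_eq_of_lt X.2, Nat.mod_eq_of_lt X'.2] at h1
    rw [Nat.mod_eq_of_lt Y.2, Nat.mod_eq_of_lt Y'.2] at h2
    exact Prod.ext (Fin.ext h1) (Fin.ext h2)
  have hbij : Function.Bijective Φ := by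
    rw [Fintype.bijective_iff_injective_and_card]
    refine ⟨hinj, ?_⟩
    simp only [Fintype.card_prod, Fintype.card_fin, Fintype.card_pi, Finset.prod_const,
      Finset.card_univ, ZMod.card]
    rw [← pow_add, ← pow_mul]
    congr 1
    rw [hh]; ring
  have hocc : ∀ X Y : ℕ, Occurs B P (((n * X + a : ℕ)) : ZMod L) (((n * Y + b : ℕ)) : ZMod L) ↔
      ∀ (i : Fin k) (j : Fin n),
        Form n h k C (n * X + (a + i)) (n * Y + (b + j)) = P i j := by
    intro X Y
    unfold Occurs
    apply forall_congr'; intro i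
    apply forall_congr'; intro j
    rw [← Nat.cast_add, ← Nat.cast_add, hB', add_assoc, add_assoc]
  have hlt : ∀ X c : ℕ, X < 2 ^ (h * k) → c < n → n * X + c < L := by
    intro X c hX hc
    rw [hL]
    have : n * (X + 1) ≤ n * 2 ^ (h * k) := Nat.mul_le_mul_left _ hX
    rw [Nat.mul_add, Nat.mul_one] at this
    omega
  obtain ⟨⟨X, Y⟩, hXY⟩ := hbij.2 P
  refine ⟨(⟨n * X + a, hlt _ _ X.2 ha⟩, ⟨n * Y + b, hlt _ _ Y.2 hb⟩), ⟨?_, ?_, ?_⟩, ?_⟩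
  · simp [Nat.mod_eq_of_lt ha]
  · simp [Nat.mod_eq_of_lt hb]
  · exact (hocc X Y).2 (fun i j => congrFun (congrFun hXY i) j)
  · rintro ⟨u, v⟩ ⟨hu, hv, ho⟩
    simp only at hu hv ho
    have eu : (u : ℕ) = n * (u / n) + a := by rw [← hu]; exact (Nat.div_add_mod _ _).symm
    have ev : (v : ℕ) = n * (v / n) + b := by rw [← hv]; exact (Nat.div_add_mod _ _).symm
    rw [eu, ev, hocc] at ho
    have bu : (u : ℕ) / n < 2 ^ (h * k) := Nat.div_lt_of_lt_mul (hL ▸ u.2)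
    have bv : (v : ℕ) / n < 2 ^ (h * k) := Nat.div_lt_of_lt_mul (hL ▸ v.2)
    have hq : Φ (⟨u / n, bu⟩, ⟨v / n, bv⟩) = Φ (X, Y) := by
      rw [hXY]
      funext i j
      exact ho i j
    have hq' := hinj hq
    rw [Prod.mk.injEq, Fin.ext_iff, Fin.ext_iff] at hq'
    obtain ⟨q1, q2⟩ := hq'
    simp only at q1 q2
    refine Prod.ext (Fin.ext ?_) (Fin.ext ?_)
    · rw [eu, q1]
    · rw [ev, q2]

theorem form_split (n h k p q x y : ℕ) (hh : n = 2 * h) (hk : k ≤ n) (hn : 0 < n)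
    (hx : x < n * 2 ^ (h * k)) (hy : y < n * 2 ^ (h * k)) :
    Form n h n (fun _ _ => 0) (p * (n * 2 ^ (h * k)) + x) (q * (n * 2 ^ (h * k)) + y) =
    Form n h k (fun i j => ∑ r ∈ Finset.Ico k n, cf n r i *
      bt (if j % 2 = 0 then p else q) (r * h + j / 2 - h * k)) x y := by
  have m1 : ∀ p x : ℕ, (p * (n * 2 ^ (h * k)) + x) % n = x % n := by
    intro p x
    rw [show p * (n * 2 ^ (h * k)) + x = n * (p * 2 ^ (h * k)) + x by ring, Nat.mul_add_mod]
  have d1 : ∀ p x : ℕ, (p * (n * 2 ^ (h * k)) + x) / n = p * 2 ^ (h * k) + x / n := by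
    intro p x
    rw [show p * (n * 2 ^ (h * k)) + x = n * (p * 2 ^ (h * k)) + x by ring, Nat.mul_add_div hn]
  have c1 : ∀ r p x : ℕ, cf n r (p * (n * 2 ^ (h * k)) + x) = cf n r x := by
    intro r p x; unfold cf; rw [m1]
  have c2 : ∀ r x : ℕ, cf n r (x % n) = cf n r x := by
    intro r x; unfold cf; rw [Nat.mod_mod]
  have hyn : y % n / 2 < h := by
    have : y % n < n := Nat.mod_lt _ hn
    omega
  have dx : x / n < 2 ^ (h * k) := Nat.div_lt_of_lt_mul hx
  have dy : y / n < 2 ^ (h * k) := Nat.div_lt_of_lt_mul hy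
  have blow : ∀ p X t : ℕ, t < h * k → bt (p * 2 ^ (h * k) + X) t = bt X t := by
    intro p X t ht
    rw [← bt_mod _ _ _ ht, ← bt_mod X _ _ ht]
    simp
  have bhigh : ∀ p X t : ℕ, X < 2 ^ (h * k) → h * k ≤ t →
      bt (p * 2 ^ (h * k) + X) t = bt p (t - h * k) := by
    intro p X t hX ht
    unfold bt
    conv_lhs => rw [show t = h * k + (t - h * k) by omega, pow_add, ← Nat.div_div_eq_div_mul,
      mul_comm p, Nat.mul_add_div (by positivity), Nat.div_eq_of_lt hX, add_zero]
  unfold Form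
  simp only [m1, d1, c1, c2, add_zero]
  rw [← Finset.sum_range_add_sum_Ico _ hk]
  congr 1
  · apply Finset.sum_congr rfl
    intro r hr
    have hr' := Finset.mem_range.1 hr
    have ht : r * h + y % n / 2 < h * k := by nlinarith
    split_ifs <;> rw [blow _ _ _ ht]
  · apply Finset.sum_congr rfl
    intro r hr
    have hr' := Finset.mem_Ico.1 hr
    have ht : h * k ≤ r * h + y % n / 2 := by
      have := Nat.mul_le_mul_left h hr'.1
      rw [mul_comm r h]
      omega
    split_ifs
    · rw [bhigh _ _ _ dx ht]
    · rw [bhigh _ _ _ dy ht]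

end NestedAux

/-- For every integer `n ≥ 2` that is a power of `2`, there exists a
nested `(n,n,n,n)`-perfect toroidal array over `𝔽₂` of size
`n·2^{n²/2} × n·2^{n²/2}`. -/
theorem existence_nested_perfect (n d : ℕ) (hnd : n = 2 ^ d) (hn : 2 ≤ n) :
    ∃ A : ZMod (n * 2 ^ (n ^ 2 / 2)) → ZMod (n * 2 ^ (n ^ 2 / 2)) → ZMod 2,
      IsNestedPerfect n A := by
  obtain ⟨h, hh⟩ : ∃ h, n = 2 * h := by
    rcases d with _ | d
    · simp at hnd; omega
    · exact ⟨2 ^ d, by rw [hnd]; ring⟩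
  have hpos : 0 < n := by omega
  have ek : ∀ k, n * k / 2 = h * k := by
    intro k
    rw [hh, mul_assoc, Nat.mul_div_cancel_left _ (by norm_num)]
  have en : n ^ 2 / 2 = h * n := by rw [pow_two, ek]
  refine ⟨fun x y => NestedAux.Form n h n (fun _ _ => 0) x.val y.val, ?_, ?_⟩
  · apply NestedAux.core n d h n _ hnd hh le_rfl hpos (by rw [en]) (fun _ _ => 0)
    intro x y hx hy
    simp only [ZMod.val_natCast, Nat.mod_eq_of_lt hx, Nat.mod_eq_of_lt hy]
  · intro k _ hk B hB
    obtain ⟨p, q, hp, hq, hB⟩ := hB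
    apply NestedAux.core n d h k _ hnd hh hk hpos (by rw [ek]) _
    · intro x y hx hy
      rw [hB ⟨x, hx⟩ ⟨y, hy⟩]
      have hlt : ∀ p x : ℕ, p < n * 2 ^ (n ^ 2 / 2) / (n * 2 ^ (n * k / 2)) →
          x < n * 2 ^ (n * k / 2) →
          p * (n * 2 ^ (n * k / 2)) + x < n * 2 ^ (n ^ 2 / 2) := by
        intro p x hp hx
        have h1 := Nat.div_mul_le_self (n * 2 ^ (n ^ 2 / 2)) (n * 2 ^ (n * k / 2))
        have h2 := Nat.mul_le_mul_right (n * 2 ^ (n * k / 2)) hp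
        rw [Nat.succ_mul] at h2
        omega
      simp only [ZMod.val_natCast]
      rw [Nat.mod_eq_of_lt (hlt p x hp hx), Nat.mod_eq_of_lt (hlt q y hq hy), ek]
      rw [ek] at hx hy
      exact NestedAux.form_split n h k p q x y hh hk hpos hx hy
end

section
/- For every integer n ≥ 2 that is a power of 2, there exist at least 2^{n²+n−1} pairwise distinct nested (n,n,n,n)-perfect toroidal arrays over 𝔽₂ of size n·2^{n²/2} × n·2^{n²/2}. -/
open Polynomial in
/-- Number of elements of `T` that are at least `j`. -/
def rotAmt (T : Finset ℕ) (j : ℕ) : ℕ := (T.filter (fun x => j ≤ x)).card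

theorem rotAmt_succ_mem (T : Finset ℕ) (j : ℕ) (h : j ∈ T) :
    rotAmt T j = rotAmt T (j+1) + 1 := by
  unfold rotAmt
  have : T.filter (fun x => j ≤ x) = insert j (T.filter (fun x => j + 1 ≤ x)) := by
    ext x; simp only [Finset.mem_filter, Finset.mem_insert]
    constructor
    · rintro ⟨h1, h2⟩
      rcases Nat.eq_or_lt_of_le h2 with h3 | h3
      · left; exact h3.symm
      · right; exact ⟨h1, h3⟩
    · rintro (rfl | ⟨h1, h2⟩)
      · exact ⟨h, le_rfl⟩
      · exact ⟨h1, by omega⟩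
  rw [this, Finset.card_insert_of_notMem]
  simp

theorem rotAmt_succ_notMem (T : Finset ℕ) (j : ℕ) (h : j ∉ T) :
    rotAmt T j = rotAmt T (j+1) := by
  unfold rotAmt
  congr 1
  ext x; simp only [Finset.mem_filter]
  constructor
  · rintro ⟨h1, h2⟩
    refine ⟨h1, ?_⟩
    rcases Nat.eq_or_lt_of_le h2 with h3 | h3
    · subst h3; exact absurd h1 h
    · exact h3
  · rintro ⟨h1, h2⟩
    exact ⟨h1, by omega⟩

theorem rotAmt_anti (T : Finset ℕ) (i j : ℕ) (h : i ≤ j) : rotAmt T j ≤ rotAmt T i := by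
  unfold rotAmt
  apply Finset.card_le_card
  intro x; simp only [Finset.mem_filter]
  rintro ⟨h1, h2⟩; exact ⟨h1, by omega⟩

theorem rotAmt_add_mono (T : Finset ℕ) (i k : ℕ) :
    rotAmt T i + i ≤ rotAmt T (i+k) + (i+k) := by
  induction k with
  | zero => simp
  | succ k ih =>
    by_cases h : i + k ∈ T
    · have := rotAmt_succ_mem T _ h
      rw [show i + (k + 1) = i + k + 1 by omega]; omega
    · have := rotAmt_succ_notMem T _ h
      rw [show i + (k + 1) = i + k + 1 by omega]; omega

theorem rotAmt_add_mono' (T : Finset ℕ) (i j : ℕ) (h : i ≤ j) :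
    rotAmt T i + i ≤ rotAmt T j + j := by
  obtain ⟨k, rfl⟩ := Nat.exists_eq_add_of_le h
  exact rotAmt_add_mono T i k

theorem rotAmt_top (n : ℕ) (T : Finset ℕ) (hT : T ⊆ Finset.range (n-1)) :
    rotAmt T (n-1) = 0 := by
  unfold rotAmt
  rw [Finset.card_eq_zero, Finset.filter_eq_empty_iff]
  intro x hx
  have := Finset.mem_range.1 (hT hx)
  omega

open Polynomial in
/-- Column polynomial. -/
noncomputable def colP (T : Finset ℕ) (l : ℕ) : (ZMod 2)[X] := X ^ rotAmt T l * (1 + X) ^ l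

open Polynomial in
theorem colP_coeff_lt (T : Finset ℕ) (l i : ℕ) (h : i < rotAmt T l) : (colP T l).coeff i = 0 := by
  unfold colP
  rw [coeff_X_pow_mul', if_neg (by omega)]

open Polynomial in
theorem colP_coeff_low (T : Finset ℕ) (l : ℕ) : (colP T l).coeff (rotAmt T l) = 1 := by
  unfold colP
  rw [coeff_X_pow_mul', if_pos le_rfl]
  simp [coeff_one_add_X_pow]

open Polynomial in
theorem colP_coeff_high (T : Finset ℕ) (l : ℕ) : (colP T l).coeff (rotAmt T l + l) = 1 := by
  unfold colP
  rw [coeff_X_pow_mul', if_pos (by omega)]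
  simp [coeff_one_add_X_pow]

open Polynomial in
theorem colP_coeff_gt (T : Finset ℕ) (l i : ℕ) (h : rotAmt T l + l < i) :
    (colP T l).coeff i = 0 := by
  unfold colP
  rw [coeff_X_pow_mul', if_pos (by omega), coeff_one_add_X_pow, Nat.choose_eq_zero_of_lt (by omega)]
  simp

open Polynomial in
/-- Combination of columns. -/
noncomputable def comb (n : ℕ) (T : Finset ℕ) (D : ℕ → ZMod 2) : (ZMod 2)[X] :=
  ∑ l ∈ Finset.range n, C (D l) * colP T l

open Polynomial in
theorem comb_coeff (n : ℕ) (T : Finset ℕ) (D : ℕ → ZMod 2) (i : ℕ) :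
    (comb n T D).coeff i = ∑ l ∈ Finset.range n, (colP T l).coeff i * D l := by
  unfold comb
  rw [finsetSum_coeff]
  refine Finset.sum_congr rfl fun l _ => ?_
  rw [coeff_C_mul, mul_comm]

open Polynomial in
theorem comb_dvd (n k : ℕ) (T : Finset ℕ) (D : ℕ → ZMod 2) (hD : ∀ l, l < k → D l = 0) :
    ((1 + X : (ZMod 2)[X]) ^ k) ∣ comb n T D := by
  unfold comb
  refine Finset.dvd_sum fun l _ => ?_
  by_cases h : l < k
  · simp [hD l h]
  · unfold colP
    exact Dvd.dvd.mul_left (Dvd.dvd.mul_left (pow_dvd_pow _ (by omega)) _) _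

theorem comb_coeff_zero_lt (n j : ℕ) (T : Finset ℕ) (D : ℕ → ZMod 2)
    (hD : ∀ l, j < l → l < n → D l = 0) (i : ℕ) (hi : i < rotAmt T j) :
    (comb n T D).coeff i = 0 := by
  rw [comb_coeff]
  refine Finset.sum_eq_zero fun l hl => ?_
  by_cases h : j < l
  · rw [hD l h (Finset.mem_range.1 hl), mul_zero]
  · rw [colP_coeff_lt, zero_mul]
    exact lt_of_lt_of_le hi (rotAmt_anti T l j (by omega))

theorem comb_coeff_zero_gt (n j : ℕ) (T : Finset ℕ) (D : ℕ → ZMod 2)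
    (hD : ∀ l, j < l → l < n → D l = 0) (i : ℕ) (hi : rotAmt T j + j < i) :
    (comb n T D).coeff i = 0 := by
  rw [comb_coeff]
  refine Finset.sum_eq_zero fun l hl => ?_
  by_cases h : j < l
  · rw [hD l h (Finset.mem_range.1 hl), mul_zero]
  · rw [colP_coeff_gt, zero_mul]
    exact lt_of_le_of_lt (rotAmt_add_mono' T l j (by omega)) hi

theorem comb_top (n j : ℕ) (hj : j < n) (T : Finset ℕ) (D : ℕ → ZMod 2)
    (hD : ∀ l, j < l → l < n → D l = 0) (h : ∀ k, j = k + 1 → k ∈ T) :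
    (comb n T D).coeff (rotAmt T j) = D j := by
  rw [comb_coeff, Finset.sum_eq_single j, colP_coeff_low, one_mul]
  · intro l hl hne
    by_cases h' : j < l
    · rw [hD l h' (Finset.mem_range.1 hl), mul_zero]
    · rw [colP_coeff_lt, zero_mul]
      obtain ⟨k, rfl⟩ : ∃ k, j = k + 1 := ⟨j - 1, by omega⟩
      have h1 := rotAmt_succ_mem T k (h k rfl)
      have h2 := rotAmt_anti T l k (by omega)
      omega
  · intro hnot; exact absurd (Finset.mem_range.2 hj) hnot

theorem comb_bot (n j : ℕ) (hj : j < n) (T : Finset ℕ) (D : ℕ → ZMod 2)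
    (hD : ∀ l, j < l → l < n → D l = 0) (h : ∀ k, j = k + 1 → k ∉ T) :
    (comb n T D).coeff (rotAmt T j + j) = D j := by
  rw [comb_coeff, Finset.sum_eq_single j, colP_coeff_high, one_mul]
  · intro l hl hne
    by_cases h' : j < l
    · rw [hD l h' (Finset.mem_range.1 hl), mul_zero]
    · rw [colP_coeff_gt, zero_mul]
      obtain ⟨k, rfl⟩ : ∃ k, j = k + 1 := ⟨j - 1, by omega⟩
      have h1 := rotAmt_succ_notMem T k (h k rfl)
      have h2 := rotAmt_add_mono' T l k (by omega)
      omega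
  · intro hnot; exact absurd (Finset.mem_range.2 hj) hnot

/-- Either the top or the bottom is exposed. -/
theorem exposed (T : Finset ℕ) (j : ℕ) : (∀ k, j = k + 1 → k ∈ T) ∨ (∀ k, j = k + 1 → k ∉ T) := by
  rcases j with _ | k
  · left; intro k hk; omega
  · by_cases h : k ∈ T
    · left; intro k' hk'; obtain rfl : k = k' := by omega
      exact h
    · right; intro k' hk'; obtain rfl : k = k' := by omega
      exact h

theorem comb_eq_zero_step (n j : ℕ) (hj : j < n) (T : Finset ℕ) (D : ℕ → ZMod 2)
    (hD : ∀ l, j < l → l < n → D l = 0) (h : comb n T D = 0) : D j = 0 := by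
  rcases exposed T j with h1 | h1
  · rw [← comb_top n j hj T D hD h1, h, Polynomial.coeff_zero]
  · rw [← comb_bot n j hj T D hD h1, h, Polynomial.coeff_zero]

theorem comb_eq_zero (n : ℕ) (T : Finset ℕ) (D : ℕ → ZMod 2)
    (h : comb n T D = 0) : ∀ j, j < n → D j = 0 := by
  have : ∀ u j, j < n → n ≤ j + u → D j = 0 := by
    intro u
    induction u with
    | zero => intro j _ _; omega
    | succ u ih =>
      intro j hj hju
      exact comb_eq_zero_step n j hj T D (fun l hl hln => ih l hln (by omega)) h
  intro j hj; exact this n j hj (by omega)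

open Polynomial in
theorem poly_small_zero (k : ℕ) (q : (ZMod 2)[X]) (hd : (1 + X : (ZMod 2)[X]) ^ k ∣ q)
    (hz : ∀ i, k ≤ i → q.coeff i = 0) : q = 0 := by
  by_contra hq
  have hmon : ((1 + X : (ZMod 2)[X]) ^ k).Monic := by
    rw [add_comm]; exact (monic_X_add_C (1 : ZMod 2)).pow k
  have hdeg : ((1 + X : (ZMod 2)[X]) ^ k).degree = k := by
    rw [degree_pow, add_comm]
    have : (X + 1 : (ZMod 2)[X]).degree = 1 := degree_X_add_C (1 : ZMod 2)
    rw [this]; simp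
  have h1 := degree_le_of_dvd hd hq
  rw [hdeg] at h1
  have h2 : q.degree < k := (degree_lt_iff_coeff_zero q k).2 hz
  exact absurd (lt_of_le_of_lt h1 h2) (lt_irrefl _)

open Polynomial in
theorem poly_window_zero (k α : ℕ) (q : (ZMod 2)[X]) (hd : (1 + X : (ZMod 2)[X]) ^ k ∣ q)
    (hz1 : ∀ i, i < α → q.coeff i = 0) (hz : ∀ i, α + k ≤ i → q.coeff i = 0) : q = 0 := by
  obtain ⟨q', rfl⟩ := X_pow_dvd_iff.2 hz1
  have hcop : IsCoprime ((1 + X : (ZMod 2)[X]) ^ k) (X ^ α) := by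
    apply IsCoprime.pow
    exact ⟨1, -1, by ring⟩
  have hd' := hcop.dvd_of_dvd_mul_left hd
  have : q' = 0 := by
    apply poly_small_zero k q' hd'
    intro i hi
    have := hz (i + α) (by omega)
    rwa [coeff_X_pow_mul] at this
  rw [this, mul_zero]

open Polynomial in
theorem poly_middle_zero (n d s a : ℕ) (hn : n = 2 ^ d) (has : a + s ≤ n) (q : (ZMod 2)[X])
    (hd : (1 + X : (ZMod 2)[X]) ^ (n - s) ∣ q)
    (hz1 : ∀ i, i < s → q.coeff (a + i) = 0) (hz : ∀ i, n ≤ i → q.coeff i = 0) : q = 0 := by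
  -- use the rotated polynomial w
  set v : (ZMod 2)[X] := divX^[a + s] q with hv
  have hvc : ∀ i, v.coeff i = q.coeff (i + (a + s)) := by
    intro i
    rw [hv]
    generalize a + s = k
    induction k generalizing i with
    | zero => simp
    | succ k ih => rw [Function.iterate_succ_apply', coeff_divX, ih]; congr 1; omega
  have hXn : (X ^ n + 1 : (ZMod 2)[X]) = (1 + X) ^ n := by
    rw [hn, add_pow_char_pow, one_pow, add_comm]
  set w : (ZMod 2)[X] := X ^ (n - a - s) * q + (X ^ n + 1) * v with hw
  have hw2 : ∀ i, w.coeff i = (if n - a - s ≤ i then q.coeff (i - (n - a - s)) else 0) +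
      ((if n ≤ i then q.coeff (i - n + (a + s)) else 0) + q.coeff (i + (a + s))) := by
    intro i
    rw [hw, coeff_add, add_mul, coeff_add, one_mul, coeff_X_pow_mul', coeff_X_pow_mul']
    simp only [hvc]
  have hwd : (1 + X : (ZMod 2)[X]) ^ (n - s) ∣ w := by
    rw [hw, hXn]
    exact dvd_add (hd.mul_left _) ((pow_dvd_pow _ (by omega)).mul_right _)
  have hw0 : w = 0 := by
    apply poly_small_zero _ _ hwd
    intro i hi
    rw [hw2, if_pos (by omega), hz (i + (a + s)) (by omega), add_zero]
    by_cases h : n ≤ i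
    · rw [if_pos h]
      have : i - n + (a + s) = i - (n - a - s) := by omega
      rw [this]; exact CharTwo.add_self_eq_zero _
    · rw [if_neg h, add_zero]
      have h3 := hz1 (i - (n - s)) (by omega)
      rw [← h3]; congr 1; omega
  ext i
  rw [coeff_zero]
  by_cases h1 : n ≤ i
  · exact hz i h1
  by_cases h2 : i < a
  · have h3 := hw2 (i + (n - a - s))
    rw [hw0, coeff_zero, if_pos (by omega), if_neg (by omega),
      hz (i + (n - a - s) + (a + s)) (by omega)] at h3
    simpa using h3.symm
  by_cases h4 : i < a + s
  · have h3 := hz1 (i - a) (by omega)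
    rw [← h3]; congr 1; omega
  · have h3 := hw2 (i - (a + s))
    rw [hw0, coeff_zero, if_neg (by omega), if_neg (by omega)] at h3
    have : i - (a + s) + (a + s) = i := by omega
    rw [this] at h3
    simpa using h3.symm

theorem comb_deg (n : ℕ) (hn : 0 < n) (T : Finset ℕ) (hT : T ⊆ Finset.range (n-1))
    (D : ℕ → ZMod 2) (i : ℕ) (hi : n ≤ i) : (comb n T D).coeff i = 0 := by
  apply comb_coeff_zero_gt n (n-1) T D (fun l h1 h2 => by omega)
  rw [rotAmt_top n T hT]; omega

theorem cyc_zero (n d s a : ℕ) (hn : n = 2 ^ d) (hs : s ≤ n) (ha : a < n)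
    (T : Finset ℕ) (hT : T ⊆ Finset.range (n-1)) (D : ℕ → ZMod 2)
    (hD : ∀ l, l < n - s → D l = 0)
    (hw : ∀ i, i < s → (comb n T D).coeff ((a + i) % n) = 0) :
    ∀ l, l < n → D l = 0 := by
  apply comb_eq_zero n T D
  have hdeg := comb_deg n (by omega) T hT D
  have hdv := comb_dvd n (n - s) T D hD
  by_cases has : a + s ≤ n
  · apply poly_middle_zero n d s a hn has _ hdv _ hdeg
    intro i hi
    have := hw i hi
    rwa [Nat.mod_eq_of_lt (by omega)] at this
  · apply poly_window_zero (n - s) (a + s - n) _ hdv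
    · intro i hi
      have := hw (i + n - a) (by omega)
      have e : (a + (i + n - a)) % n = i := by
        rw [show a + (i + n - a) = i + n by omega, Nat.add_mod_right, Nat.mod_eq_of_lt (by omega)]
      rwa [e] at this
    · intro i hi
      by_cases h : n ≤ i
      · exact hdeg i h
      · have := hw (i - a) (by omega)
        have e : (a + (i - a)) % n = i := by
          rw [show a + (i - a) = i by omega, Nat.mod_eq_of_lt (by omega)]
        rwa [e] at this

/-- One peeling step with mixed rows. -/
theorem mixed_step (n d s a j : ℕ) (hn : n = 2 ^ d) (hs : s ≤ n) (ha : a < n) (hj : j < n)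
    (T : Finset ℕ) (hT : T ⊆ Finset.range (n-1)) {ι : Type*} (D E : ι → ℕ → ZMod 2)
    (hD : ∀ e l, l < n - s → D e l = 0) (hE : ∀ e l, l < n - s → E e l = 0)
    (hD' : ∀ e l, j < l → l < n → D e l = 0) (hE' : ∀ e l, j < l → l < n → E e l = 0)
    (hw : ∀ e i, i < s → (comb n T (if (a + i) / n = 0 then D e else E e)).coeff ((a + i) % n) = 0) :
    (∀ e, D e j = 0) ∨ (∀ e, E e j = 0) := by
  by_cases has : a + s ≤ n
  · left
    intro e
    apply cyc_zero n d s a hn hs ha T hT (D e) (hD e) _ j hj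
    intro i hi
    have := hw e i hi
    rwa [if_pos (Nat.div_eq_of_lt (by omega))] at this
  have hwD : ∀ e i, a ≤ i → i < n → (comb n T (D e)).coeff i = 0 := by
    intro e i h1 h2
    have := hw e (i - a) (by omega)
    rw [show a + (i - a) = i by omega, Nat.mod_eq_of_lt h2, if_pos (Nat.div_eq_of_lt h2)] at this
    exact this
  have hwE : ∀ e i, i < a + s - n → (comb n T (E e)).coeff i = 0 := by
    intro e i h1
    have := hw e (i + n - a) (by omega)
    rw [show a + (i + n - a) = i + n by omega, Nat.add_mod_right, Nat.mod_eq_of_lt (by omega),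
      if_neg (by rw [Nat.add_div_right _ (by omega)]; exact Nat.succ_ne_zero _)] at this
    exact this
  have hb : rotAmt T j + j ≤ n - 1 := by
    have := rotAmt_add_mono' T j (n-1) (by omega)
    rw [rotAmt_top n T hT] at this; omega
  have hdegD := fun e => comb_deg n (by omega) T hT (D e)
  rcases exposed T j with h1 | h1
  · by_cases h2 : rotAmt T j < a + s - n
    · right; intro e
      rw [← comb_top n j hj T (E e) (hE' e) h1]
      exact hwE e _ h2
    · left; intro e
      apply comb_eq_zero n T (D e) _ j hj
      apply poly_window_zero (n - s) (a + s - n) _ (comb_dvd n (n-s) T (D e) (hD e))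
      · intro i hi
        exact comb_coeff_zero_lt n j T (D e) (hD' e) i (by omega)
      · intro i hi
        by_cases h : n ≤ i
        · exact hdegD e i h
        · exact hwD e i (by omega) (by omega)
  · by_cases h2 : a ≤ rotAmt T j + j
    · left; intro e
      rw [← comb_bot n j hj T (D e) (hD' e) h1]
      exact hwD e _ h2 (by omega)
    · right; intro e
      apply comb_eq_zero n T (E e) _ j hj
      apply poly_window_zero (n - s) (a + s - n) _ (comb_dvd n (n-s) T (E e) (hE e))
      · exact hwE e
      · intro i hi
        exact comb_coeff_zero_gt n j T (E e) (hE' e) i (by omega)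

/-- Bit of `r` at position `t`, as an element of the field. -/
def bv (r t : ℕ) : ZMod 2 := if r.testBit t then 1 else 0

theorem bv_eq_iff (r r' t t' : ℕ) : bv r t = bv r' t' ↔ r.testBit t = r'.testBit t' := by
  unfold bv
  cases r.testBit t <;> cases r'.testBit t' <;> simp

theorem bv_aff_lt (p y k t : ℕ) (h : t < k) : bv (2^k*p + y % 2^k) t = bv y t := by
  rw [bv_eq_iff, Nat.testBit_two_pow_mul_add _ (Nat.mod_lt _ (Nat.two_pow_pos k)), if_pos h,
    Nat.testBit_mod_two_pow]
  simp [h]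

theorem bv_aff_ge (p y k t : ℕ) (h : k ≤ t) : bv (2^k*p + y % 2^k) t = bv p (t - k) := by
  rw [bv_eq_iff, Nat.testBit_two_pow_mul_add _ (Nat.mod_lt _ (Nat.two_pow_pos k)),
    if_neg (by omega)]

theorem modEq_iff_bv (r r' m : ℕ) : r ≡ r' [MOD 2^m] ↔ ∀ t, t < m → bv r t = bv r' t := by
  simp only [bv_eq_iff]
  constructor
  · intro h t ht
    have h1 := congrArg (fun x => Nat.testBit x t) h
    simpa [Nat.testBit_mod_two_pow, ht] using h1
  · intro h
    apply Nat.eq_of_testBit_eq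
    intro t
    rw [Nat.testBit_mod_two_pow, Nat.testBit_mod_two_pow]
    by_cases ht : t < m
    · simp [ht, h t ht]
    · simp [ht]

/-- Entry of the block `(r,c)` at `(i,j)`. -/
noncomputable def cell (n : ℕ) (T : Finset ℕ) (Z : ℕ → ℕ → ZMod 2) (r c i j : ℕ) : ZMod 2 :=
  Z i j + ∑ l ∈ Finset.range n,
    (colP T l).coeff i * bv (if j % 2 = 0 then r else c) ((n-1-l)*(n/2) + (n-1-j)/2)

/-- Digit differences. -/
def dif (n e x x' l : ℕ) : ZMod 2 := bv x ((n-1-l)*(n/2)+e) - bv x' ((n-1-l)*(n/2)+e)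

theorem cell_eq (n : ℕ) (T : Finset ℕ) (Z : ℕ → ℕ → ZMod 2) (r c r' c' i j : ℕ)
    (h : cell n T Z r c i j = cell n T Z r' c' i j) :
    (comb n T (dif n ((n-1-j)/2) (if j % 2 = 0 then r else c)
      (if j % 2 = 0 then r' else c'))).coeff i = 0 := by
  unfold cell at h
  rw [comb_coeff]
  have h1 := add_left_cancel h
  unfold dif
  simp only [mul_sub, Finset.sum_sub_distrib]
  rw [h1, sub_self]

theorem dif_hi (n e s x x' p l : ℕ) (hs : s ≤ n) (h : l < n - s) :
    dif n e (2^(s*(n/2))*p + x % 2^(s*(n/2))) (2^(s*(n/2))*p + x' % 2^(s*(n/2))) l = 0 := by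
  unfold dif
  have : s*(n/2) ≤ (n-1-l)*(n/2)+e :=
    le_trans (Nat.mul_le_mul_right _ (by omega)) (Nat.le_add_right _ _)
  rw [bv_aff_ge _ _ _ _ this, bv_aff_ge _ _ _ _ this, sub_self]

theorem pos_lt (n e s l : ℕ) (he : e < n/2) (h : n - s ≤ l) (hl : l < n) :
    (n-1-l)*(n/2)+e < s*(n/2) := by
  have h1 : (n-1-l+1)*(n/2) ≤ s*(n/2) := Nat.mul_le_mul_right _ (by omega)
  rw [add_mul, one_mul] at h1
  omega

theorem dif_lo (n e s x x' p l : ℕ) (he : e < n/2) (h : n - s ≤ l) (hl : l < n) :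
    dif n e (2^(s*(n/2))*p + x % 2^(s*(n/2))) (2^(s*(n/2))*p + x' % 2^(s*(n/2))) l
      = dif n e x x' l := by
  unfold dif
  have := pos_lt n e s l he h hl
  rw [bv_aff_lt _ _ _ _ this, bv_aff_lt _ _ _ _ this]

/-- Window entries. -/
noncomputable def wnd (n s : ℕ) (T : Finset ℕ) (Z : ℕ → ℕ → ZMod 2) (p q a b r c i j : ℕ) :
    ZMod 2 :=
  cell n T Z (2^(s*(n/2))*p + (r + (a+i)/n) % 2^(s*(n/2)))
    (2^(s*(n/2))*q + (c + (b+j)/n) % 2^(s*(n/2))) ((a+i)%n) ((b+j)%n)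

theorem exists_col (n b j0 : ℕ) (hb : b < n) (hj : j0 < n) :
    ∃ j, j < n ∧ (b + j) % n = j0 := by
  by_cases h : b ≤ j0
  · exact ⟨j0 - b, by omega, by rw [show b + (j0 - b) = j0 by omega, Nat.mod_eq_of_lt hj]⟩
  · exact ⟨j0 + n - b, by omega, by
      rw [show b + (j0 + n - b) = j0 + n by omega, Nat.add_mod_right, Nat.mod_eq_of_lt hj]⟩

theorem wnd_inj_c (n d s : ℕ) (hn : n = 2 ^ d) (hn2 : n % 2 = 0) (hs : s ≤ n)
    (T : Finset ℕ) (hT : T ⊆ Finset.range (n-1)) (Z : ℕ → ℕ → ZMod 2)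
    (p q a b r c r' c' : ℕ) (ha : a < n) (hb : b < n)
    (hw : ∀ i j, i < s → j < n →
      wnd n s T Z p q a b r c i j = wnd n s T Z p q a b r' c' i j) :
    c ≡ c' [MOD 2^(s*(n/2))] := by
  have key : ∀ e, e < n/2 → ∃ δ, ∀ l, n - s ≤ l → l < n → dif n e (c+δ) (c'+δ) l = 0 := by
    intro e he
    obtain ⟨j, hj, hj0⟩ := exists_col n b (n-1-2*e) hb (by omega)
    refine ⟨(b+j)/n, fun l hl hln => ?_⟩
    rw [← dif_lo n e s _ _ q l he hl hln]
    apply cyc_zero n d s a hn hs ha T hT _ _ _ l hln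
    · intro l hl; exact dif_hi n e s _ _ q l hs hl
    · intro i hi
      have h1 := cell_eq _ _ _ _ _ _ _ _ _ (hw i j hi hj)
      rw [hj0, if_neg (by omega), if_neg (by omega), show (n-1-(n-1-2*e))/2 = e by omega] at h1
      exact h1
  have step : ∀ t, t ≤ s*(n/2) → c ≡ c' [MOD 2^t] := by
    intro t
    induction t with
    | zero => intro _; simp [Nat.modEq_one]
    | succ t ih =>
      intro ht
      have ih' := ih (by omega)
      have hH : 0 < n/2 := by
        rcases Nat.eq_zero_or_pos (n/2) with h | h
        · rw [h] at ht; omega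
        · exact h
      have hq : t/(n/2) < s := (Nat.div_lt_iff_lt_mul hH).2 (by omega)
      obtain ⟨δ, hδ⟩ := key (t % (n/2)) (Nat.mod_lt _ hH)
      obtain ⟨v, hv⟩ : ∃ v, v = t/(n/2) := ⟨_, rfl⟩
      rw [← hv] at hq
      have h1 := hδ (n-1-v) (by clear hv; omega) (by clear hv; omega)
      unfold dif at h1
      rw [show n-1-(n-1-v) = v by clear hv; omega, hv, Nat.div_add_mod', sub_eq_zero] at h1
      have h2 : c + δ ≡ c' + δ [MOD 2^t] := ih'.add_right δ
      have h3 : c + δ ≡ c' + δ [MOD 2^(t+1)] := by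
        rw [modEq_iff_bv] at h2 ⊢
        intro t' ht'
        rcases Nat.lt_succ_iff_lt_or_eq.1 ht' with h | h
        · exact h2 t' h
        · rw [h]; exact h1
      exact Nat.ModEq.add_right_cancel' δ h3
  exact step _ le_rfl

theorem wnd_inj_r (n d s : ℕ) (hn : n = 2 ^ d) (hn2 : n % 2 = 0) (hs : s ≤ n)
    (T : Finset ℕ) (hT : T ⊆ Finset.range (n-1)) (Z : ℕ → ℕ → ZMod 2)
    (p q a b r c r' c' : ℕ) (ha : a < n) (hb : b < n)
    (hw : ∀ i j, i < s → j < n →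
      wnd n s T Z p q a b r c i j = wnd n s T Z p q a b r' c' i j) :
    r ≡ r' [MOD 2^(s*(n/2))] := by
  set F : ℕ → ℕ → ℕ → ZMod 2 := fun δ e => dif n e
    (2^(s*(n/2))*p + (r+δ) % 2^(s*(n/2))) (2^(s*(n/2))*p + (r'+δ) % 2^(s*(n/2))) with hF
  have key : ∀ e, e < n/2 → ∀ i, i < s → (comb n T (F ((a+i)/n) e)).coeff ((a+i)%n) = 0 := by
    intro e he i hi
    obtain ⟨j, hj, hj0⟩ := exists_col n b (n-2-2*e) hb (by omega)
    have h1 := cell_eq _ _ _ _ _ _ _ _ _ (hw i j hi hj)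
    rw [hj0, if_pos (by omega), if_pos (by omega), show (n-1-(n-2-2*e))/2 = e by omega] at h1
    exact h1
  have hF0 : ∀ δ e l, l < n - s → F δ e l = 0 := fun δ e l hl => dif_hi n e s _ _ p l hs hl
  have hF1 : ∀ δ e l, e < n/2 → n - s ≤ l → l < n → F δ e l = dif n e (r+δ) (r'+δ) l :=
    fun δ e l he h1 h2 => dif_lo n e s _ _ p l he h1 h2
  have up : ∀ δ u, r ≡ r' [MOD 2^(u*(n/2))] → u < s →
      (∀ e : Fin (n/2), F δ e (n-1-u) = 0) → r ≡ r' [MOD 2^((u+1)*(n/2))] := by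
    intro δ u h hu hz
    apply Nat.ModEq.add_right_cancel' δ
    have h2 := h.add_right δ
    rw [modEq_iff_bv] at h2 ⊢
    intro t ht
    by_cases htu : t < u*(n/2)
    · exact h2 t htu
    · rw [add_mul, one_mul] at ht
      have h3 := hz ⟨t - u*(n/2), by omega⟩
      rw [hF1 _ _ _ (by simp only; omega) (by omega) (by omega)] at h3
      unfold dif at h3
      rw [show n-1-(n-1-u) = u by omega, sub_eq_zero] at h3
      simp only at h3
      rwa [show u*(n/2) + (t - u*(n/2)) = t by omega] at h3
  have step : ∀ u, u ≤ s → r ≡ r' [MOD 2^(u*(n/2))] := by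
    intro u
    induction u with
    | zero => intro _; simp [Nat.modEq_one]
    | succ u ih =>
      intro hu
      have ih' := ih (by omega)
      have low : ∀ δ (e : Fin (n/2)) l, n-1-u < l → l < n → F δ e l = 0 := by
        intro δ e l h1 h2
        rw [hF1 _ _ _ e.2 (by omega) h2]
        unfold dif
        rw [sub_eq_zero]
        exact (modEq_iff_bv _ _ _).1 (ih'.add_right δ) _ (pos_lt n e u l e.2 (by omega) h2)
      have := mixed_step n d s a (n-1-u) hn hs ha (by omega) T hT
        (fun e : Fin (n/2) => F 0 e) (fun e : Fin (n/2) => F 1 e)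
        (fun e l hl => hF0 _ _ _ hl) (fun e l hl => hF0 _ _ _ hl)
        (low 0) (low 1) (by
          intro e i hi
          have h1 := key e e.2 i hi
          by_cases h : (a+i)/n = 0
          · rw [if_pos h]; rw [h] at h1; exact h1
          · rw [if_neg h]
            have : (a+i)/n = 1 := by
              have : (a+i)/n < 2 := (Nat.div_lt_iff_lt_mul (by omega)).2 (by omega)
              revert h this
              generalize (a+i)/n = z
              intro h this
              omega
            rw [this] at h1; exact h1)
      rcases this with h | h
      · exact up 0 u ih' (by omega) h
      · exact up 1 u ih' (by omega) h
  exact step s le_rfl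

theorem wnd_bij (n d s : ℕ) (hn : n = 2 ^ d) (hn2 : n % 2 = 0) (hs : s ≤ n)
    (T : Finset ℕ) (hT : T ⊆ Finset.range (n-1)) (Z : ℕ → ℕ → ZMod 2)
    (p q a b : ℕ) (ha : a < n) (hb : b < n) :
    Function.Bijective (fun (rc : Fin (2^(s*(n/2))) × Fin (2^(s*(n/2)))) (i : Fin s) (j : Fin n) =>
      wnd n s T Z p q a b rc.1 rc.2 i j) := by
  rw [Fintype.bijective_iff_injective_and_card]
  constructor
  · rintro ⟨r, c⟩ ⟨r', c'⟩ h
    have hw : ∀ i j, i < s → j < n →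
      wnd n s T Z p q a b r c i j = wnd n s T Z p q a b r' c' i j := by
      intro i j hi hj
      exact congrFun (congrFun h ⟨i, hi⟩) ⟨j, hj⟩
    have h1 := wnd_inj_r n d s hn hn2 hs T hT Z p q a b r c r' c' ha hb hw
    have h2 := wnd_inj_c n d s hn hn2 hs T hT Z p q a b r c r' c' ha hb hw
    have h3 := Nat.ModEq.eq_of_lt_of_lt h1 r.2 r'.2
    have h4 := Nat.ModEq.eq_of_lt_of_lt h2 c.2 c'.2
    exact Prod.ext (Fin.ext h3) (Fin.ext h4)
  · simp only [Fintype.card_prod, Fintype.card_fin, Fintype.card_fun, ZMod.card]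
    rw [← pow_add, ← pow_mul]
    congr 1
    rw [← mul_add, mul_comm]
    congr 1; omega

theorem perfect_core (n d s N : ℕ) (hn : n = 2 ^ d) (hn2 : n % 2 = 0) (hs : s ≤ n)
    (T : Finset ℕ) (hT : T ⊆ Finset.range (n-1)) (Z : ℕ → ℕ → ZMod 2)
    (hN : N = n * 2^(s*(n/2))) (p q : ℕ) (B : ZMod N → ZMod N → ZMod 2)
    (hB : ∀ x y : ℕ, x < N → y < N → B (x : ZMod N) (y : ZMod N) =
      cell n T Z (2^(s*(n/2))*p + x/n) (2^(s*(n/2))*q + y/n) (x%n) (y%n)) :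
    IsPerfect N s n n n B := by
  intro P a b ha hb
  have hn0 : 0 < n := by omega
  have hR : 0 < 2^(s*(n/2)) := Nat.two_pow_pos _
  have hN0 : 0 < N := by rw [hN]; positivity
  have hB' : ∀ x y : ℕ, B (x : ZMod N) (y : ZMod N) =
      cell n T Z (2^(s*(n/2))*p + (x/n) % 2^(s*(n/2))) (2^(s*(n/2))*q + (y/n) % 2^(s*(n/2)))
        (x%n) (y%n) := by
    intro x y
    have h := hB (x % N) (y % N) (Nat.mod_lt _ hN0) (Nat.mod_lt _ hN0)
    rw [ZMod.natCast_mod, ZMod.natCast_mod] at h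
    rw [h, hN, Nat.mod_mul_right_div_self, Nat.mod_mul_right_div_self, Nat.mod_mul_right_mod,
      Nat.mod_mul_right_mod]
  have occ : ∀ r c : ℕ, Occurs B P ((n*r+a : ℕ) : ZMod N) ((n*c+b : ℕ) : ZMod N) ↔
      ∀ (i : Fin s) (j : Fin n), wnd n s T Z p q a b r c i j = P i j := by
    intro r c
    unfold Occurs
    refine forall_congr' fun i => forall_congr' fun j => ?_
    rw [← Nat.cast_add, ← Nat.cast_add, hB', add_assoc, add_assoc, Nat.mul_add_div hn0,
      Nat.mul_add_div hn0, Nat.mul_add_mod, Nat.mul_add_mod]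
    rfl
  obtain ⟨⟨r, c⟩, hrc, huniq⟩ :=
    (wnd_bij n d s hn hn2 hs T hT Z p q a b ha hb).existsUnique P
  have bound : ∀ (u : Fin (2^(s*(n/2)))) (a : ℕ), a < n → n*u+a < N := by
    intro u a ha
    have h1 : n*(u.1+1) ≤ n * 2^(s*(n/2)) := Nat.mul_le_mul_left _ u.2
    rw [mul_add, mul_one, ← hN] at h1
    omega
  refine ⟨(⟨n*r+a, bound r a ha⟩, ⟨n*c+b, bound c b hb⟩), ⟨?_, ?_, ?_⟩, ?_⟩
  · simp [Nat.mul_add_mod, Nat.mod_eq_of_lt ha]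
  · simp [Nat.mul_add_mod, Nat.mod_eq_of_lt hb]
  · simp only
    rw [occ]
    intro i j
    exact congrFun (congrFun hrc i) j
  · rintro ⟨⟨k, hk⟩, ⟨l, hl⟩⟩ ⟨h1, h2, h3⟩
    simp only at h1 h2 h3
    have ek : k = n*(k/n) + a := by rw [← h1, Nat.div_add_mod]
    have el : l = n*(l/n) + b := by rw [← h2, Nat.div_add_mod]
    have hk' : k/n < 2^(s*(n/2)) := by
      apply Nat.div_lt_of_lt_mul; rw [← hN]; exact hk
    have hl' : l/n < 2^(s*(n/2)) := by
      apply Nat.div_lt_of_lt_mul; rw [← hN]; exact hl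
    rw [ek, el, occ] at h3
    have := huniq (⟨k/n, hk'⟩, ⟨l/n, hl'⟩) (by
      funext i j; exact h3 i j)
    rw [Prod.ext_iff, Fin.ext_iff, Fin.ext_iff] at this
    simp only at this
    obtain ⟨e1, e2⟩ := this
    rw [Prod.ext_iff, Fin.ext_iff, Fin.ext_iff]
    simp only
    rw [← e1, ← e2]
    exact ⟨ek, el⟩

/-- The array. -/
noncomputable def arr (n N : ℕ) (T : Finset ℕ) (Z : ℕ → ℕ → ZMod 2) :
    ZMod N → ZMod N → ZMod 2 :=
  fun x y => cell n T Z (x.val/n) (y.val/n) (x.val%n) (y.val%n)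

theorem arr_apply (n N : ℕ) (T : Finset ℕ) (Z : ℕ → ℕ → ZMod 2) (x y : ℕ) (hx : x < N)
    (hy : y < N) : arr n N T Z x y = cell n T Z (x/n) (y/n) (x%n) (y%n) := by
  unfold arr
  rw [ZMod.val_natCast, ZMod.val_natCast, Nat.mod_eq_of_lt hx, Nat.mod_eq_of_lt hy]

theorem arr_perfect (n d : ℕ) (hn : n = 2 ^ d) (hn2 : n % 2 = 0)
    (T : Finset ℕ) (hT : T ⊆ Finset.range (n-1)) (Z : ℕ → ℕ → ZMod 2) :
    IsNestedPerfect n (arr n (n * 2 ^ (n ^ 2 / 2)) T Z) := by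
  have hdiv : ∀ k, n*k/2 = k*(n/2) := by
    intro k
    rw [mul_comm, Nat.mul_div_assoc]
    omega
  have hsq : n^2/2 = n*(n/2) := by rw [sq, hdiv]
  constructor
  · apply perfect_core n d n _ hn hn2 le_rfl T hT Z (by rw [hsq]) 0 0
    intro x y hx hy
    rw [arr_apply _ _ _ _ _ _ hx hy]
    simp
  · intro k hk1 hk B ⟨p, q, hp, hq, hB⟩
    have hn0 : 0 < n := by omega
    apply perfect_core n d k _ hn hn2 hk T hT Z (by rw [hdiv]) p q
    intro x y hx hy
    have h := hB ⟨x, hx⟩ ⟨y, hy⟩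
    simp only at h
    have bound : ∀ p x, p < n * 2 ^ (n ^ 2 / 2) / (n * 2 ^ (n * k / 2)) →
        x < n * 2 ^ (n * k / 2) → p * (n * 2 ^ (n * k / 2)) + x < n * 2 ^ (n ^ 2 / 2) := by
      intro p x hp hx
      have h1 := (Nat.le_div_iff_mul_le (by positivity)).1 (Nat.succ_le_of_lt hp)
      rw [Nat.succ_mul] at h1
      omega
    rw [h, arr_apply _ _ _ _ _ _ (bound p x hp hx) (bound q y hq hy), hdiv]
    have e1 : ∀ p x, p * (n * 2^(k*(n/2))) + x = n * (2^(k*(n/2)) * p) + x := by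
      intro p x; ring
    rw [e1, e1, Nat.mul_add_div hn0, Nat.mul_add_div hn0, Nat.mul_add_mod, Nat.mul_add_mod]

/-- Extension of a finite matrix by zero. -/
def zext (n : ℕ) (Z : Fin n → Fin n → ZMod 2) (i j : ℕ) : ZMod 2 :=
  if h : i < n ∧ j < n then Z ⟨i, h.1⟩ ⟨j, h.2⟩ else 0

theorem bv_zero (t : ℕ) : bv 0 t = 0 := by simp [bv]

theorem bv_two_pow (t t' : ℕ) : bv (2^t) t' = if t = t' then 1 else 0 := by
  unfold bv; rw [Nat.testBit_two_pow]; simp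

theorem arr_inj (n : ℕ) (hn0 : 2 ≤ n) (hn2 : n % 2 = 0)
    (T T' : Finset ℕ) (hT : T ⊆ Finset.range (n-1)) (hT' : T' ⊆ Finset.range (n-1))
    (Z Z' : Fin n → Fin n → ZMod 2)
    (h : arr n (n * 2 ^ (n ^ 2 / 2)) T (zext n Z) = arr n (n * 2 ^ (n ^ 2 / 2)) T' (zext n Z')) :
    T = T' ∧ Z = Z' := by
  have hsq : n^2/2 = n*(n/2) := by rw [sq, Nat.mul_div_assoc]; omega
  have hcell : ∀ r c i j, r < 2^(n^2/2) → c < 2^(n^2/2) → i < n → j < n →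
      cell n T (zext n Z) r c i j = cell n T' (zext n Z') r c i j := by
    intro r c i j hr hc hi hj
    have bound : ∀ r i, r < 2^(n^2/2) → i < n → n * r + i < n * 2^(n^2/2) := by
      intro r i hr hi
      have h1 : n*(r+1) ≤ n * 2^(n^2/2) := Nat.mul_le_mul_left _ hr
      rw [mul_add, mul_one] at h1
      omega
    have h1 := congrFun (congrFun h ((n*r+i : ℕ) : ZMod _)) ((n*c+j : ℕ) : ZMod _)
    rw [arr_apply _ _ _ _ _ _ (bound r i hr hi) (bound c j hc hj),
      arr_apply _ _ _ _ _ _ (bound r i hr hi) (bound c j hc hj),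
      Nat.mul_add_div (by omega), Nat.mul_add_div (by omega), Nat.mul_add_mod, Nat.mul_add_mod,
      Nat.mod_eq_of_lt hi, Nat.mod_eq_of_lt hj, Nat.div_eq_of_lt hi, Nat.div_eq_of_lt hj] at h1
    exact h1
  have hZ : Z = Z' := by
    funext i j
    have h1 := hcell 0 0 i j (Nat.two_pow_pos _) (Nat.two_pow_pos _) i.2 j.2
    unfold cell at h1
    simpa [bv_zero, zext] using h1
  refine ⟨?_, hZ⟩
  subst hZ
  have hcoef : ∀ l i, l < n → i < n → (colP T l).coeff i = (colP T' l).coeff i := by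
    intro l i hl hi
    have hlt : (n-1-l)*(n/2) + (n-1-0)/2 < n^2/2 := by
      rw [hsq]; exact pos_lt n _ n l (by omega) (by omega) hl
    have h1 := hcell (2^((n-1-l)*(n/2) + (n-1-0)/2)) 0 i 0
      (Nat.pow_lt_pow_right (by norm_num) hlt) (Nat.two_pow_pos _) hi (by omega)
    unfold cell at h1
    have h2 := add_left_cancel h1
    have hs : ∀ T : Finset ℕ, ∑ x ∈ Finset.range n, (colP T x).coeff i *
        bv (if 0 % 2 = 0 then 2^((n-1-l)*(n/2) + (n-1-0)/2) else 0)
          ((n-1-x)*(n/2) + (n-1-0)/2) = (colP T l).coeff i := by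
      intro T
      rw [Finset.sum_eq_single l]
      · rw [if_pos (by norm_num), bv_two_pow, if_pos rfl, mul_one]
      · intro x hx hne
        rw [if_pos (by norm_num), bv_two_pow, if_neg, mul_zero]
        intro he
        have h3 := Nat.add_right_cancel he
        have h4 := Nat.eq_of_mul_eq_mul_right (by omega) h3
        have := Finset.mem_range.1 hx
        omega
      · intro h; exact absurd (Finset.mem_range.2 hl) h
    rw [hs, hs] at h2
    exact h2
  have hle : ∀ T T' : Finset ℕ, T ⊆ Finset.range (n-1) →
      (∀ l i, l < n → i < n → (colP T l).coeff i = (colP T' l).coeff i) →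
      ∀ l, l < n → rotAmt T' l ≤ rotAmt T l := by
    intro T T' hT hc l hl
    by_contra hlt
    have hb : rotAmt T l < n := by
      have := rotAmt_add_mono' T l (n-1) (by omega)
      rw [rotAmt_top n T hT] at this; omega
    have h1 := hc l (rotAmt T l) hl hb
    rw [colP_coeff_low, colP_coeff_lt _ _ _ (by omega)] at h1
    exact one_ne_zero h1
  have hrot : ∀ l, l < n → rotAmt T l = rotAmt T' l := fun l hl =>
    le_antisymm (hle T' T hT' (fun l i h1 h2 => (hcoef l i h1 h2).symm) l hl)
      (hle T T' hT hcoef l hl)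
  have hsub : ∀ T T' : Finset ℕ, T ⊆ Finset.range (n-1) →
      (∀ l, l < n → rotAmt T l = rotAmt T' l) → T ⊆ T' := by
    intro T T' hT hr x hx
    by_contra hx'
    have := Finset.mem_range.1 (hT hx)
    have h1 := rotAmt_succ_mem T x hx
    have h2 := rotAmt_succ_notMem T' x hx'
    have h3 := hr x (by omega)
    have h4 := hr (x+1) (by omega)
    omega
  exact Finset.Subset.antisymm (hsub T T' hT hrot) (hsub T' T hT' fun l hl => (hrot l hl).symm)

/-- For every integer `n ≥ 2` that is a power of `2`, there exist at least
`2^{n²+n−1}` pairwise distinct nested `(n,n,n,n)`-perfect toroidal arrays over `𝔽₂`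
of size `n·2^{n²/2} × n·2^{n²/2}`. -/
theorem count_nested_perfect (n d : ℕ) (hnd : n = 2 ^ d) (hn : 2 ≤ n) :
    ∃ S : Finset (ZMod (n * 2 ^ (n ^ 2 / 2)) → ZMod (n * 2 ^ (n ^ 2 / 2)) → ZMod 2),
      2 ^ (n ^ 2 + n - 1) ≤ S.card ∧ ∀ A ∈ S, IsNestedPerfect n A := by
  classical
  have hn2 : n % 2 = 0 := by
    rcases d with _ | d
    · simp at hnd; omega
    · rw [hnd, pow_succ]; omega
  refine ⟨(((Finset.range (n-1)).powerset ×ˢ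
    (Finset.univ : Finset (Fin n → Fin n → ZMod 2))).image
      fun TZ => arr n (n * 2 ^ (n ^ 2 / 2)) TZ.1 (zext n TZ.2)), ?_, ?_⟩
  · rw [Finset.card_image_of_injOn]
    · rw [Finset.card_product, Finset.card_powerset, Finset.card_range, Finset.card_univ]
      simp only [Fintype.card_fun, Fintype.card_fin, ZMod.card]
      rw [← pow_mul, ← pow_add]
      apply le_of_eq
      congr 1
      rw [sq]; omega
    · rintro ⟨T, Z⟩ h1 ⟨T', Z'⟩ h2 h
      simp only [Finset.coe_product, Set.mem_prod, Finset.mem_coe, Finset.mem_powerset] at h1 h2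
      obtain ⟨e1, e2⟩ := arr_inj n hn hn2 T T' h1.1 h2.1 Z Z' h
      rw [e1, e2]
  · intro A hA
    obtain ⟨⟨T, Z⟩, hTZ, rfl⟩ := Finset.mem_image.1 hA
    simp only [Finset.mem_product, Finset.mem_powerset] at hTZ
    exact arr_perfect n d hnd hn2 T hTZ.1 _
end

section
/- For all integers d, i, j with d ≥ 0, 0 < i < 2^d and 0 ≤ j < 2^d − 1, the matrix M_d satisfies (M_d)_{i,j} = (M_d)_{i−1,j} + (M_d)_{i,j+1}, where + is addition in 𝔽₂. -/
theorem MdEnt_row_zero (d j : ℕ) : MdEnt d 0 j = 1 := by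
  induction d generalizing j with
  | zero => simp [MdEnt]
  | succ d ih => simp [MdEnt, ih]

theorem MdEnt_last_col (d i : ℕ) (hi : i < 2 ^ d) : MdEnt d i (2 ^ d - 1) = 1 := by
  induction d generalizing i with
  | zero => simp [MdEnt]
  | succ d ih =>
    have hp := Nat.two_pow_pos d
    rw [pow_succ] at hi ⊢
    have h1 : ¬ (2 ^ d * 2 - 1 < 2 ^ d) := by omega
    have h2 : 2 ^ d * 2 - 1 - 2 ^ d = 2 ^ d - 1 := by omega
    simp only [MdEnt, h1, h2, if_false]
    split_ifs with h
    · exact ih i h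
    · exact ih _ (by omega)

theorem MdEnt_col_zero (d i : ℕ) (h0 : 0 < i) (hi : i < 2 ^ d) : MdEnt d i 0 = 0 := by
  induction d generalizing i with
  | zero => simp at hi; omega
  | succ d ih =>
    have hp := Nat.two_pow_pos d
    simp only [MdEnt, hp, if_true]
    split_ifs with h
    · exact ih i h0 h
    · rfl

theorem MdEnt_last_row (d j : ℕ) (hj : j < 2 ^ d - 1) : MdEnt d (2 ^ d - 1) j = 0 := by
  induction d generalizing j with
  | zero => simp at hj
  | succ d ih =>
    have hp := Nat.two_pow_pos d
    rw [pow_succ] at hj ⊢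
    have h1 : ¬ (2 ^ d * 2 - 1 < 2 ^ d) := by omega
    have h2 : 2 ^ d * 2 - 1 - 2 ^ d = 2 ^ d - 1 := by omega
    simp only [MdEnt, h1, h2, if_false]
    split_ifs with h
    · rfl
    · exact ih _ (by omega)

theorem MdEnt_rec (d i j : ℕ) (hi : i + 1 < 2 ^ d) (hj : j + 1 < 2 ^ d) :
    MdEnt d (i + 1) j = MdEnt d i j + MdEnt d (i + 1) (j + 1) := by
  induction d generalizing i j with
  | zero => simp at hi
  | succ d ih =>
    have hp := Nat.two_pow_pos d
    rw [pow_succ] at hi hj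
    have two : (1 : ZMod 2) + 1 = 0 := by decide
    simp only [MdEnt]
    rcases lt_trichotomy (i + 1) (2 ^ d) with h | h | h
    · have a : i < 2 ^ d := by omega
      rcases lt_trichotomy (j + 1) (2 ^ d) with k | k | k
      · have b : j < 2 ^ d := by omega
        simp only [a, b, h, k, if_true]
        exact ih i j h k
      · have b : j < 2 ^ d := by omega
        have c : j = 2 ^ d - 1 := by omega
        have e : ¬ (j + 1 < 2 ^ d) := by omega
        have f : j + 1 - 2 ^ d = 0 := by omega
        simp only [a, b, h, e, f, if_true, if_false]
        rw [c, MdEnt_last_col d _ h, MdEnt_last_col d _ a,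
          MdEnt_col_zero d _ (by omega) h, add_zero]
      · have b : ¬ (j < 2 ^ d) := by omega
        have e : ¬ (j + 1 < 2 ^ d) := by omega
        have f : j + 1 - 2 ^ d = j - 2 ^ d + 1 := by omega
        simp only [a, b, h, e, f, if_true, if_false]
        exact ih _ _ h (by omega)
    · have a : i < 2 ^ d := by omega
      have a' : ¬ (i + 1 < 2 ^ d) := by omega
      have c' : i + 1 - 2 ^ d = 0 := by omega
      have c : i = 2 ^ d - 1 := by omega
      rcases lt_trichotomy (j + 1) (2 ^ d) with k | k | k
      · have b : j < 2 ^ d := by omega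
        simp only [a, a', b, k, if_true, if_false]
        rw [c, MdEnt_last_row d j (by omega), add_zero]
      · have b : j < 2 ^ d := by omega
        have e : ¬ (j + 1 < 2 ^ d) := by omega
        have f : j = 2 ^ d - 1 := by omega
        simp only [a, a', b, e, c', if_true, if_false]
        rw [MdEnt_row_zero, f, MdEnt_last_col d i a, two]
      · have b : ¬ (j < 2 ^ d) := by omega
        have e : ¬ (j + 1 < 2 ^ d) := by omega
        simp only [a, a', b, e, c', if_true, if_false]
        rw [MdEnt_row_zero, MdEnt_row_zero, c, MdEnt_last_row d _ (by omega), zero_add]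
    · have a : ¬ (i < 2 ^ d) := by omega
      have a' : ¬ (i + 1 < 2 ^ d) := by omega
      have c : i + 1 - 2 ^ d = i - 2 ^ d + 1 := by omega
      rcases lt_trichotomy (j + 1) (2 ^ d) with k | k | k
      · have b : j < 2 ^ d := by omega
        simp only [a, a', b, k, if_true, if_false, add_zero]
      · have b : j < 2 ^ d := by omega
        have e : ¬ (j + 1 < 2 ^ d) := by omega
        have f : j + 1 - 2 ^ d = 0 := by omega
        simp only [a, a', b, e, f, if_true, if_false]
        rw [MdEnt_col_zero d _ (by omega) (by omega), add_zero]
      · have b : ¬ (j < 2 ^ d) := by omega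
        have e : ¬ (j + 1 < 2 ^ d) := by omega
        have f : j + 1 - 2 ^ d = j - 2 ^ d + 1 := by omega
        simp only [a, a', b, e, c, f, if_false]
        exact ih _ _ (by omega) (by omega)

/-- For all `d ≥ 0`, `0 < i < 2^d`, `0 ≤ j < 2^d − 1`:
`(M_d)_{i,j} = (M_d)_{i−1,j} + (M_d)_{i,j+1}` in `𝔽₂`. -/
theorem Md_pascal_recurrence (d i j : ℕ) (hi0 : 0 < i) (hi : i < 2 ^ d)
    (hj : j < 2 ^ d - 1) :
    Md d ⟨i, hi⟩ ⟨j, by omega⟩ =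
      Md d ⟨i - 1, by omega⟩ ⟨j, by omega⟩ + Md d ⟨i, hi⟩ ⟨j + 1, by omega⟩ := by
  obtain ⟨i, rfl⟩ : ∃ k, i = k + 1 := ⟨i - 1, by omega⟩
  exact MdEnt_rec d i j hi (by omega)
end

section
/- Let d ≥ 0, n = 2^d, and let M = M_d^{m_0,…,m_{n−1}} be a Pascal-like matrix. For all integers ℓ and k with 0 ≤ ℓ < ℓ + k ≤ n, the k × k submatrix of M given by the k consecutive rows ℓ, ℓ+1, …, ℓ+k−1 and the last k columns n−k, …, n−1 is invertible over 𝔽₂. -/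
open Polynomial in
lemma choose_two_pow_add (d i j : ℕ) :
    (((2 ^ d + j).choose i : ℕ) : ZMod 2) =
      (j.choose i : ZMod 2) + if 2 ^ d ≤ i then (j.choose (i - 2 ^ d) : ZMod 2) else 0 := by
  have h : ((1 + X : (ZMod 2)[X]) ^ (2 ^ d + j)) = (1 + X) ^ j + (1 + X) ^ j * X ^ (2 ^ d) := by
    rw [pow_add, add_pow_char_pow]
    ring
  have h2 := congrArg (fun p => p.coeff i) h
  simpa only [coeff_add, coeff_one_add_X_pow, coeff_mul_X_pow'] using h2

lemma MdEnt_eq (d : ℕ) : ∀ i j : ℕ, i < 2 ^ d → j < 2 ^ d →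
    MdEnt d i j = (j.choose i : ZMod 2) := by
  induction d with
  | zero =>
    intro i j hi hj
    obtain rfl : i = 0 := by simpa using hi
    simp [MdEnt]
  | succ d ih =>
    intro i j hi hj
    rw [pow_succ] at hi hj
    simp only [MdEnt]
    by_cases h1 : i < 2 ^ d
    · by_cases h2 : j < 2 ^ d
      · simp [h1, h2, ih i j h1 h2]
      · obtain ⟨t, rfl⟩ := Nat.exists_eq_add_of_le (not_lt.mp h2)
        rw [choose_two_pow_add]
        simp [h1, ih i t h1 (by omega)]
    · by_cases h2 : j < 2 ^ d
      · simp [h1, h2, Nat.choose_eq_zero_of_lt (show j < i by omega)]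
      · obtain ⟨t, rfl⟩ := Nat.exists_eq_add_of_le (not_lt.mp h2)
        rw [choose_two_pow_add, Nat.choose_eq_zero_of_lt (show t < i by omega)]
        simp [h1, not_lt.mp h1, ih (i - 2 ^ d) t (by omega) (by omega)]

lemma MdEnt_last (d : ℕ) : ∀ i : ℕ, i < 2 ^ d → MdEnt d i (2 ^ d - 1) = 1 := by
  induction d with
  | zero => intro i _; simp [MdEnt]
  | succ d ih =>
    intro i hi
    have hp := Nat.two_pow_pos d
    rw [pow_succ] at hi
    simp only [MdEnt]
    have e : 2 ^ (d + 1) - 1 - 2 ^ d = 2 ^ d - 1 := by rw [pow_succ]; omega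
    have e2 : ¬ (2 ^ (d + 1) - 1 < 2 ^ d) := by rw [pow_succ]; omega
    rw [e, if_neg e2, if_neg e2]
    split_ifs with h
    · exact ih i h
    · exact ih _ (by omega)

/-- The rotation as a linear map. -/
def sigmaLin (n : ℕ) [NeZero n] : Module.End (ZMod 2) (Fin n → ZMod 2) where
  toFun := sigmaStep
  map_add' _ _ := rfl
  map_smul' _ _ := rfl

/-- Identity plus rotation. -/
def tauLin (n : ℕ) [NeZero n] : Module.End (ZMod 2) (Fin n → ZMod 2) := 1 + sigmaLin n

lemma tau_apply (n : ℕ) [NeZero n] (w : Fin n → ZMod 2) (i : Fin n) :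
    tauLin n w i = w i + w (i - 1) := rfl

lemma sigma_pow_apply (n : ℕ) [NeZero n] (t : ℕ) (w : Fin n → ZMod 2) :
    (sigmaLin n ^ t) w = sigmaStep^[t] w := by
  rw [Module.End.pow_apply]; rfl

lemma fin_sub_one (n : ℕ) [NeZero n] (i : ℕ) (h : i + 1 < n) :
    (⟨i + 1, h⟩ : Fin n) - 1 = ⟨i, by omega⟩ := by
  rw [sub_eq_iff_eq_add]
  apply Fin.ext
  rw [Fin.val_add, Fin.val_one', Nat.mod_eq_of_lt (show 1 < n by omega), Nat.mod_eq_of_lt h]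

lemma vanish_of_window (n : ℕ) [NeZero n] (k : ℕ) : ∀ (l : ℕ) (w : Fin n → ZMod 2),
    (tauLin n ^ k) w = 0 → l + k ≤ n →
    (∀ a (h : l + a < n), a < k → w ⟨l + a, h⟩ = 0) → w = 0 := by
  induction k with
  | zero => intro l w h _ _; simpa using h
  | succ k ih =>
    intro l w h hl hw
    have hT : tauLin n w = 0 := by
      apply ih (l + 1) (tauLin n w)
      · rw [pow_succ] at h; exact h
      · omega
      · intro a ha hak
        have e : (⟨l + 1 + a, ha⟩ : Fin n) = ⟨l + a + 1, by omega⟩ := by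
          apply Fin.ext; simp only []; omega
        rw [tau_apply, e, fin_sub_one n (l + a) (by omega), hw a (by omega) (by omega)]
        have := hw (a + 1) (by omega) (by omega)
        rw [add_zero]
        exact this
    have hstep : ∀ i : Fin n, w i = w (i - 1) := by
      intro i
      have := congrFun hT i
      rw [tau_apply] at this
      exact CharTwo.add_eq_zero.mp this
    have hc : ∀ i (hi : i < n), w ⟨i, hi⟩ = w 0 := by
      intro i
      induction i with
      | zero => intro hi; rfl
      | succ i ihi => intro hi; rw [hstep, fin_sub_one, ihi]
    have h0 : w 0 = 0 := by
      rw [← hc l (by omega)]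
      exact hw 0 (by omega) (by omega)
    funext i
    rw [show i = ⟨i.1, i.2⟩ from rfl, hc, h0]; rfl

/-- The `j`-th column of `M_d`, for a natural number `j`. -/
def colN (d j : ℕ) : Fin (2 ^ d) → ZMod 2 := fun r => MdEnt d r j

lemma tau_col (d j : ℕ) (hj : j + 1 < 2 ^ d) : tauLin (2 ^ d) (colN d j) = colN d (j + 1) := by
  funext ⟨i, hi⟩
  rw [tau_apply]
  cases i with
  | zero =>
    have e : (((⟨0, hi⟩ : Fin (2 ^ d)) - 1 : Fin (2 ^ d)) : ℕ) = 2 ^ d - 1 := by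
      rw [Fin.sub_def]
      simp only [Fin.val_one', Nat.mod_eq_of_lt (show 1 < 2 ^ d by omega)]
      exact Nat.mod_eq_of_lt (by omega)
    simp only [colN, e]
    rw [MdEnt_eq d _ _ hi (by omega), MdEnt_eq d _ _ (by omega) (by omega),
      MdEnt_eq d _ _ hi hj, Nat.choose_eq_zero_of_lt (show j < 2 ^ d - 1 by omega)]
    simp
  | succ i =>
    rw [fin_sub_one]
    simp only [colN]
    rw [MdEnt_eq d _ _ hi (by omega), MdEnt_eq d _ _ (by omega) (by omega),
      MdEnt_eq d _ _ hi hj, Nat.choose_succ_succ]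
    push_cast
    ring

lemma col_last (d : ℕ) : colN d (2 ^ d - 1) = fun _ => 1 := by
  funext i
  exact MdEnt_last d i i.2

lemma tau_pow_col (d t : ℕ) : ∀ j, j + t < 2 ^ d →
    (tauLin (2 ^ d) ^ t) (colN d j) = colN d (j + t) := by
  induction t with
  | zero => intro j _; rfl
  | succ t ih =>
    intro j hj
    rw [pow_succ, Module.End.mul_apply, tau_col d j (by omega), ih (j + 1) (by omega)]
    congr 1; omega

lemma tau_pow_col_zero (d t j : ℕ) (hj : j < 2 ^ d) (h : 2 ^ d ≤ j + t) :
    (tauLin (2 ^ d) ^ t) (colN d j) = 0 := by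
  obtain ⟨s, rfl⟩ := Nat.exists_eq_add_of_le (show 2 ^ d - 1 - j + 1 ≤ t by omega)
  rw [add_comm, pow_add, pow_succ', Module.End.mul_apply, Module.End.mul_apply,
    tau_pow_col d _ j (by omega), show j + (2 ^ d - 1 - j) = 2 ^ d - 1 by omega, col_last]
  have : tauLin (2 ^ d) (fun _ => 1) = 0 := by
    funext i
    rw [tau_apply]
    exact CharTwo.add_self_eq_zero 1
  rw [this, map_zero]

lemma tau_pow_sigma_pow (n : ℕ) [NeZero n] (s t : ℕ) (w : Fin n → ZMod 2) :
    (tauLin n ^ s) ((sigmaLin n ^ t) w) = (sigmaLin n ^ t) ((tauLin n ^ s) w) := by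
  have h : Commute (tauLin n) (sigmaLin n) := by
    unfold tauLin
    exact (Commute.one_left _).add_left (Commute.refl _)
  exact LinearMap.congr_fun (h.pow_pow s t).eq w

lemma sigma_pow_one (n : ℕ) [NeZero n] (t : ℕ) :
    (sigmaLin n ^ t) (fun _ => 1) = fun _ => 1 := by
  induction t with
  | zero => rfl
  | succ t ih => rw [pow_succ', Module.End.mul_apply, ih]; rfl

/-- For a Pascal-like matrix `M = M_d^{m_0,…,m_{n−1}}` (`n = 2^d`) and
`0 ≤ ℓ < ℓ + k ≤ n`, the `k × k` submatrix of `M` given by rows `ℓ,…,ℓ+k−1` and the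
last `k` columns `n−k,…,n−1` is invertible over `𝔽₂`. -/
theorem pascalLike_right_submatrix_invertible (d : ℕ) (m : Fin (2 ^ d) → ℕ)
    (hm : Admissible m) (ℓ k : ℕ) (hk : 0 < k) (hlk : ℓ + k ≤ 2 ^ d) :
    IsUnit (Matrix.of fun a b : Fin k =>
      pascalLike d m ⟨ℓ + (a : ℕ), by have := a.isLt; omega⟩
        ⟨2 ^ d - k + (b : ℕ), by have := b.isLt; omega⟩) := by
  have hinj : ∀ v : Fin k → ZMod 2, (Matrix.of fun a b : Fin k =>
      pascalLike d m ⟨ℓ + (a : ℕ), by have := a.isLt; omega⟩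
        ⟨2 ^ d - k + (b : ℕ), by have := b.isLt; omega⟩).mulVec v = 0 → v = 0 := by
    intro v hv
    let mm : Fin k → ℕ := fun b => m ⟨2 ^ d - k + (b : ℕ), by have := b.isLt; omega⟩
    let w : Fin (2 ^ d) → ZMod 2 :=
      ∑ b : Fin k, v b • (sigmaLin (2 ^ d) ^ mm b) (colN d (2 ^ d - k + b))
    have htw : ∀ t, (tauLin (2 ^ d) ^ t) w = ∑ b : Fin k,
        v b • (sigmaLin (2 ^ d) ^ mm b) ((tauLin (2 ^ d) ^ t) (colN d (2 ^ d - k + b))) := by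
      intro t
      simp only [w, map_sum, map_smul, tau_pow_sigma_pow]
    have hw : w = 0 := by
      apply vanish_of_window (2 ^ d) k ℓ w
      · rw [htw]
        refine Finset.sum_eq_zero fun b _ => ?_
        rw [tau_pow_col_zero d k _ (by have := b.isLt; omega) (by omega), map_zero, smul_zero]
      · exact hlk
      · intro a ha hak
        have h := congrFun hv ⟨a, hak⟩
        simp only [Matrix.mulVec, dotProduct, Matrix.of_apply, Pi.zero_apply] at h
        rw [← h]
        simp only [w, Finset.sum_apply, Pi.smul_apply, smul_eq_mul]
        refine Finset.sum_congr rfl fun b _ => ?_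
        rw [sigma_pow_apply, mul_comm]
        rfl
    have key : ∀ b (hb : b < k), v ⟨b, hb⟩ = 0 := by
      intro b
      induction b using Nat.strong_induction_on with
      | _ b ih =>
        intro hb
        have h := htw (k - 1 - b)
        rw [hw, map_zero, Finset.sum_eq_single ⟨b, hb⟩] at h
        · rw [tau_pow_col d _ _ (by simp only []; omega),
            show 2 ^ d - k + b + (k - 1 - b) = 2 ^ d - 1 by omega, col_last, sigma_pow_one] at h
          have := congrFun h 0
          simpa using this.symm
        · intro c _ hc
          have hcb : (c : ℕ) ≠ b := fun e => hc (Fin.ext e)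
          have := c.isLt
          rcases lt_or_gt_of_ne hcb with h1 | h1
          · rw [show v c = 0 from ih c h1 c.isLt, zero_smul]
          · rw [tau_pow_col_zero d _ _ (by omega) (by omega), map_zero, smul_zero]
        · intro h; exact absurd (Finset.mem_univ _) h
    funext b
    exact key b b.isLt
  rw [← Matrix.mulVec_injective_iff_isUnit]
  intro x y hxy
  rw [← sub_eq_zero]
  apply hinj
  rw [Matrix.mulVec_sub, sub_eq_zero]
  exact hxy
end

section
/- Let d ≥ 0, n = 2^d, and let M = M_d^{m_0,…,m_{n−1}} be a Pascal-like matrix. Let 1 ≤ k ≤ n. Any k × k submatrix of M given by k consecutive rows and k consecutive columns whose top right entry lies on the upper border of M is invertible over 𝔽₂. -/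
open Polynomial in
theorem aux_indep (k : ℕ) : ∀ (v : ℕ → ZMod 2) (t : ℕ → ℕ),
    (∑ b ∈ Finset.range k, C (v b) * (X ^ t b * (1 + X) ^ b) : (ZMod 2)[X]) = 0 →
    ∀ b < k, v b = 0 := by
  induction k with
  | zero => intro v t h b hb; omega
  | succ k ih =>
    intro v t h
    rw [Finset.sum_range_succ'] at h
    have e : (∑ b ∈ Finset.range k, C (v (b+1)) * (X ^ t (b+1) * (1 + X) ^ (b+1)) : (ZMod 2)[X])
        = (∑ b ∈ Finset.range k, C (v (b+1)) * (X ^ t (b+1) * (1 + X) ^ b)) * (1 + X) := by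
      rw [Finset.sum_mul]
      refine Finset.sum_congr rfl fun b _ => ?_
      ring
    rw [e] at h
    have h0 : v 0 = 0 := by
      have h1 := congrArg (Polynomial.eval (1 : ZMod 2)) h
      have h2 : (1 : ZMod 2) + 1 = 0 := by decide
      simpa [h2] using h1
    have hne : (1 + X : (ZMod 2)[X]) ≠ 0 := by
      intro hh
      have := congrArg (Polynomial.eval (0 : ZMod 2)) hh
      simp at this
    have h3 : (∑ b ∈ Finset.range k, C (v (b+1)) * (X ^ t (b+1) * (1 + X) ^ b) : (ZMod 2)[X]) = 0 := by
      rw [h0] at h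
      simp only [map_zero, zero_mul, add_zero] at h
      exact (mul_eq_zero.mp h).resolve_right hne
    have h4 := ih (fun b => v (b+1)) (fun b => t (b+1)) h3
    intro b hb
    rcases b with _ | b
    · exact h0
    · exact h4 b (by omega)

open Polynomial in
theorem aux_deg (j : ℕ) : ((1 + X : (ZMod 2)[X]) ^ j).natDegree = j := by
  have : (1 + X : (ZMod 2)[X]) = X + C 1 := by simp [add_comm]
  rw [this, natDegree_pow, natDegree_X_add_C, mul_one]

open Polynomial in
theorem aux_MdEnt (d : ℕ) : ∀ i j, i < 2 ^ d → j < 2 ^ d →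
    MdEnt d i j = ((1 + X : (ZMod 2)[X]) ^ j).coeff i := by
  induction d with
  | zero =>
    intro i j hi hj
    obtain rfl : i = 0 := by simpa using hi
    obtain rfl : j = 0 := by simpa using hj
    simp [MdEnt]
  | succ d ih =>
    intro i j hi hj
    have key : 2 ^ d ≤ j → (1 + X : (ZMod 2)[X]) ^ j
        = (1 + X) ^ (j - 2 ^ d) + (1 + X) ^ (j - 2 ^ d) * X ^ (2 ^ d) := by
      intro h
      have h1 : (1 + X : (ZMod 2)[X]) ^ (2 ^ d) = 1 + X ^ (2 ^ d) := by
        rw [add_pow_char_pow, one_pow]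
      conv_lhs => rw [← Nat.sub_add_cancel h, pow_add, h1]
      ring
    rw [pow_succ] at hi hj
    unfold MdEnt
    split_ifs with h1 h2 h3
    · exact ih i j h1 h2
    · rw [key (by omega), coeff_add, coeff_mul_X_pow', if_neg (by omega), add_zero]
      exact ih _ _ h1 (by omega)
    · exact (coeff_eq_zero_of_natDegree_lt (by rw [aux_deg]; omega)).symm
    · rw [key (by omega), coeff_add, coeff_mul_X_pow', if_pos (by omega),
        coeff_eq_zero_of_natDegree_lt (by rw [aux_deg]; omega), zero_add]
      exact ih _ _ (by omega) (by omega)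

open Polynomial in
theorem aux_sigma {n : ℕ} [NeZero n] (p : (ZMod 2)[X]) (q : ℕ) :
    p.natDegree + q < n → ∀ i : Fin n,
    (sigmaStep^[q] (fun r : Fin n => p.coeff r)) i = (p * X ^ q).coeff i := by
  induction q with
  | zero => intro _ i; simp
  | succ q ih =>
    intro h i
    rw [Function.iterate_succ_apply']
    unfold sigmaStep
    have := ih (by omega)
    unfold sigmaStep at this
    rw [this, pow_succ, ← mul_assoc]
    obtain ⟨n, rfl⟩ : ∃ n', n = n' + 1 := ⟨n - 1, by omega⟩
    by_cases hi : i = 0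
    · subst hi
      have h2 : (((0 : Fin (n+1)) - 1 : Fin (n+1)) : ℕ) = n := by
        simp [Fin.coe_neg_one]
      rw [h2]
      simp only [Fin.val_zero, mul_coeff_zero, coeff_X_zero, mul_zero]
      apply coeff_eq_zero_of_natDegree_lt
      have := natDegree_mul_le (p := p) (q := X ^ q)
      rw [natDegree_X_pow] at this
      omega
    · have h2 : ((i - 1 : Fin (n+1)) : ℕ) = i - 1 := by
        rw [Fin.val_sub_one_of_ne_zero hi]
      have h3 : (i : ℕ) ≠ 0 := fun h => hi (Fin.ext h)
      rw [h2]
      obtain ⟨w, hw⟩ : ∃ w, (i : ℕ) = w + 1 := ⟨i - 1, by omega⟩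
      rw [hw, coeff_mul_X]; rfl

theorem aux_m {n : ℕ} (m : Fin n → ℕ) (hm : Admissible m) (e : ℕ) :
    ∀ i j : Fin n, (i : ℕ) + e = j → m j ≤ m i ∧ m i ≤ m j + e := by
  induction e with
  | zero => intro i j h; obtain rfl : i = j := Fin.ext h
            simp
  | succ e ih =>
    intro i j h
    have hj := j.isLt
    have h1 := ih i ⟨i + e, by omega⟩ rfl
    have h2 := hm.2 ⟨i + e, by omega⟩ j (by simp; omega)
    omega

open Polynomial in
theorem aux_pascal (d : ℕ) (m : Fin (2 ^ d) → ℕ) (hm : Admissible m) (i j : Fin (2 ^ d)) :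
    pascalLike d m i j = ((1 + X : (ZMod 2)[X]) ^ (j : ℕ) * X ^ m j).coeff i := by
  have hj := j.isLt
  have h1 := aux_m m hm (2 ^ d - 1 - j) j ⟨2 ^ d - 1, by omega⟩ (by simp; omega)
  have h2 := hm.1 ⟨2 ^ d - 1, by omega⟩ rfl
  rw [← aux_sigma _ _ (by rw [aux_deg]; omega)]
  unfold pascalLike Md
  simp only [Matrix.of_apply]
  have e : (fun r : Fin (2 ^ d) => MdEnt d r j)
      = fun r : Fin (2 ^ d) => ((1 + X : (ZMod 2)[X]) ^ (j : ℕ)).coeff r :=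
    funext fun r => aux_MdEnt d r j r.isLt hj
  rw [e]

/-- For a Pascal-like matrix `M = M_d^{m_0,…,m_{n−1}}` (`n = 2^d`) and
`1 ≤ k ≤ n`, any `k × k` submatrix of `M` given by `k` consecutive rows and `k`
consecutive columns whose top right entry lies on the upper border of `M` is
invertible over `𝔽₂`. -/
theorem pascalLike_top_submatrix_invertible (d : ℕ) (m : Fin (2 ^ d) → ℕ)
    (hm : Admissible m) (k r s : ℕ) (hk : 1 ≤ k)
    (hr : r + k ≤ 2 ^ d) (hs : s + k ≤ 2 ^ d)
    (hub : UpperBorder (pascalLike d m) ⟨r, by omega⟩ ⟨s + k - 1, by omega⟩) :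
    IsUnit (Matrix.of fun a b : Fin k =>
      pascalLike d m ⟨r + (a : ℕ), by have := a.isLt; omega⟩
        ⟨s + (b : ℕ), by have := b.isLt; omega⟩) := by
  have hentry := aux_pascal d m hm
  generalize pascalLike d m = M at *
  have hlast : m ⟨s + k - 1, by omega⟩ = r := by
    obtain ⟨h1, h2⟩ := hub
    have hb := aux_m m hm (2 ^ d - 1 - (s + k - 1)) ⟨s + k - 1, by omega⟩
      ⟨2 ^ d - 1, by omega⟩ (by simp; omega)
    have hz := hm.1 ⟨2 ^ d - 1, by omega⟩ rfl
    rcases lt_trichotomy (m ⟨s + k - 1, by omega⟩) r with h | h | h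
    · have h3 := h2 ⟨m ⟨s + k - 1, by omega⟩, by omega⟩ h
      rw [hentry, Polynomial.coeff_mul_X_pow', if_pos le_rfl, Nat.sub_self] at h3
      simp [Polynomial.coeff_zero_eq_eval_zero] at h3
    · exact h
    · rw [hentry, Polynomial.coeff_mul_X_pow', if_neg (by simpa using h)] at h1
      simp at h1
  let t : ℕ → ℕ := fun b => if h : s + b < 2 ^ d then m ⟨s + b, h⟩ - r else 0
  have ht : ∀ b (hb : b < k), m ⟨s + b, by omega⟩ = t b + r ∧ t b + b < k := by
    intro b hb
    have := aux_m m hm (k - 1 - b) ⟨s + b, by omega⟩ ⟨s + k - 1, by omega⟩ (by simp; omega)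
    simp only [t, dif_pos (show s + b < 2 ^ d by omega)]
    omega
  rw [← Matrix.mulVec_injective_iff_isUnit]
  refine (injective_iff_map_eq_zero (Matrix.mulVecLin _)).2 ?_
  intro v hv
  let v' : ℕ → ZMod 2 := fun b => if h : b < k then v ⟨b, h⟩ else 0
  let Q : Polynomial (ZMod 2) := ∑ b ∈ Finset.range k,
    Polynomial.C (v' b) * (Polynomial.X ^ t b * (1 + Polynomial.X) ^ b)
  have hdvd : (Polynomial.X : Polynomial (ZMod 2)) ^ k ∣ (1 + Polynomial.X) ^ s * Q := by
    rw [Polynomial.X_pow_dvd_iff]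
    intro a ha
    have h1 := congrFun hv ⟨a, ha⟩
    simp only [Matrix.mulVecLin_apply, Matrix.mulVec, dotProduct, Matrix.of_apply,
      Pi.zero_apply] at h1
    rw [← h1]
    simp only [Q]
    rw [Finset.mul_sum, Polynomial.finsetSum_coeff, Finset.sum_range]
    refine Finset.sum_congr rfl fun b _ => ?_
    rw [hentry, (ht b b.isLt).1]
    have hv' : v' b = v b := by simp [v']
    rw [hv']
    have e1 : (1 + Polynomial.X : Polynomial (ZMod 2)) ^ s *
        (Polynomial.C (v b) * (Polynomial.X ^ t b * (1 + Polynomial.X) ^ (b : ℕ)))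
        = Polynomial.C (v b) * ((1 + Polynomial.X) ^ (s + b) * Polynomial.X ^ t b) := by ring
    have e2 : (1 + Polynomial.X : Polynomial (ZMod 2)) ^ (s + (b : ℕ)) *
        Polynomial.X ^ (t b + r) = ((1 + Polynomial.X) ^ (s + (b : ℕ)) * Polynomial.X ^ t b) *
          Polynomial.X ^ r := by ring
    rw [e1, Polynomial.coeff_C_mul, mul_comm]
    simp only
    rw [e2, add_comm r a, Polynomial.coeff_mul_X_pow]
  have hcop : IsCoprime ((Polynomial.X : Polynomial (ZMod 2)) ^ k) ((1 + Polynomial.X) ^ s) := by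
    apply IsCoprime.pow
    exact ⟨-1, 1, by ring⟩
  have hdvd2 := hcop.dvd_of_dvd_mul_left hdvd
  have hQ : Q = 0 := by
    apply Polynomial.eq_zero_of_dvd_of_degree_lt hdvd2
    rw [Polynomial.degree_X_pow]
    refine (Polynomial.degree_sum_le _ _).trans_lt ?_
    rw [Finset.sup_lt_iff (by exact_mod_cast WithBot.bot_lt_coe k)]
    intro b hb
    have hb := Finset.mem_range.1 hb
    refine lt_of_le_of_lt Polynomial.degree_le_natDegree ?_
    have h1 := Polynomial.natDegree_C_mul_le (v' b)
      (Polynomial.X ^ t b * (1 + Polynomial.X) ^ b : Polynomial (ZMod 2))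
    have h2 := Polynomial.natDegree_mul_le (p := (Polynomial.X ^ t b : Polynomial (ZMod 2)))
      (q := (1 + Polynomial.X) ^ b)
    rw [aux_deg, Polynomial.natDegree_X_pow] at h2
    have := (ht b hb).2
    exact_mod_cast (by omega : _ < k)
  have hz := aux_indep k v' t hQ
  funext b
  have := hz b b.isLt
  simpa [v'] using this
end

section
/- Let d ≥ 0, n = 2^d and 1 ≤ k ≤ n. Then: (i) for every ℓ with 0 ≤ ℓ ≤ n−k, the k × k submatrix of M_d given by rows ℓ,…,ℓ+k−1 and the last k columns n−k,…,n−1 is invertible over 𝔽₂; and (ii) for every s with 0 ≤ s ≤ n−k, the k × k submatrix of M_d given by the top k rows 0,…,k−1 and columns s,…,s+k−1 is invertible over 𝔽₂. -/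
theorem MdEnt_eq_s7 (d i j : ℕ) (hi : i < 2 ^ d) (hj : j < 2 ^ d) :
    MdEnt d i j = ((1 + Polynomial.X : Polynomial (ZMod 2)) ^ j).coeff i := by
  induction d generalizing i j with
  | zero =>
    have h1 : i = 0 := by simpa using hi
    have h2 : j = 0 := by simpa using hj
    subst h1 h2
    simp [MdEnt]
  | succ d ih =>
    have h2 : 2 ^ (d + 1) = 2 ^ d + 2 ^ d := by ring
    rw [MdEnt]
    by_cases hj' : j < 2 ^ d
    · by_cases hi' : i < 2 ^ d
      · simp [hi', hj', ih]
      · simp only [hi', hj', if_true, if_false]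
        rw [Polynomial.coeff_one_add_X_pow, Nat.choose_eq_zero_of_lt (by omega)]
        simp
    · have hp : (1 + Polynomial.X : Polynomial (ZMod 2)) ^ j =
          (1 + Polynomial.X) ^ (j - 2 ^ d) + (1 + Polynomial.X) ^ (j - 2 ^ d) * Polynomial.X ^ (2 ^ d) := by
        conv_lhs => rw [show j = (j - 2 ^ d) + 2 ^ d by omega, pow_add, add_pow_char_pow]
        ring
      rw [hp, Polynomial.coeff_add, Polynomial.coeff_mul_X_pow']
      by_cases hi' : i < 2 ^ d
      · simp only [hi', hj', if_true, if_false]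
        rw [ih _ _ hi' (by omega), if_neg (by omega), add_zero]
      · simp only [hi', hj', if_false]
        rw [ih _ _ (by omega) (by omega), if_pos (by omega),
          Polynomial.coeff_one_add_X_pow (ZMod 2) (j - 2 ^ d) i,
          Nat.choose_eq_zero_of_lt (by omega)]
        simp

theorem MdEnt_symm (d i j : ℕ) (hi : i < 2 ^ d) (hj : j < 2 ^ d) :
    MdEnt d i j = MdEnt d (2 ^ d - 1 - j) (2 ^ d - 1 - i) := by
  induction d generalizing i j with
  | zero => simp [MdEnt]
  | succ d ih =>
    have h2 : 2 ^ (d + 1) = 2 ^ d + 2 ^ d := by ring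
    rw [MdEnt, MdEnt, h2]
    by_cases hi' : i < 2 ^ d <;> by_cases hj' : j < 2 ^ d
    · rw [if_pos hi', if_pos hj', if_neg (by omega), if_neg (by omega), ih _ _ hi' hj']
      congr 1 <;> omega
    · rw [if_pos hi', if_neg hj', if_pos (by omega), if_neg (by omega),
        ih _ _ hi' (by omega)]
      congr 1 <;> omega
    · rw [if_neg hi', if_pos hj', if_neg (by omega), if_pos (by omega)]
    · rw [if_neg hi', if_neg hj', if_pos (by omega), if_pos (by omega),
        ih _ _ (by omega) (by omega)]
      congr 1 <;> omega

theorem isUnit_choose (k s : ℕ) :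
    IsUnit (Matrix.of fun a b : Fin k => (((s + (b : ℕ)).choose (a : ℕ) : ℕ) : ZMod 2)) := by
  let L : Matrix (Fin k) (Fin k) (ZMod 2) := Matrix.of fun a c =>
    if (c : ℕ) ≤ a then ((s.choose ((a : ℕ) - c) : ℕ) : ZMod 2) else 0
  let U : Matrix (Fin k) (Fin k) (ZMod 2) := Matrix.of fun c b =>
    (((b : ℕ).choose (c : ℕ) : ℕ) : ZMod 2)
  have hLU : (Matrix.of fun a b : Fin k => (((s + (b : ℕ)).choose (a : ℕ) : ℕ) : ZMod 2))
      = L * U := by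
    ext a b
    rw [Matrix.mul_apply]
    simp only [L, U, Matrix.of_apply]
    rw [Fin.sum_univ_eq_sum_range (fun c => (if c ≤ (a : ℕ) then
      ((s.choose ((a : ℕ) - c) : ℕ) : ZMod 2) else 0) * (((b : ℕ).choose c : ℕ) : ZMod 2)) k,
      add_comm s, Nat.add_choose_eq, Finset.Nat.sum_antidiagonal_eq_sum_range_succ_mk]
    push_cast
    have hsub : Finset.range (a : ℕ).succ ⊆ Finset.range k := by
      intro x hx
      have := a.isLt
      simp only [Finset.mem_range] at *
      omega
    rw [← Finset.sum_subset hsub]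
    · apply Finset.sum_congr rfl
      intro c hc
      rw [if_pos (by simp at hc; omega), mul_comm]
    · intro c _ hc
      rw [if_neg (by simp at hc; omega), zero_mul]
  rw [hLU, Matrix.isUnit_iff_isUnit_det, Matrix.det_mul]
  have hL : L.det = 1 := by
    rw [Matrix.det_of_lowerTriangular]
    · simp [L]
    · intro a c h
      have h' : (a : ℕ) < c := h
      simp only [L, Matrix.of_apply]
      rw [if_neg (by omega)]
  have hU : U.det = 1 := by
    rw [Matrix.det_of_upperTriangular]
    · simp [U]
    · intro c b h
      have h' : (b : ℕ) < c := h
      simp only [U, Matrix.of_apply]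
      rw [Nat.choose_eq_zero_of_lt h']
      simp
  simp [hL, hU]

theorem isUnit_top (d k s : ℕ) (hs : s + k ≤ 2 ^ d) :
    IsUnit (Matrix.of fun a b : Fin k => MdEnt d (a : ℕ) (s + (b : ℕ))) := by
  convert isUnit_choose k s using 1
  ext a b
  have := a.isLt
  have := b.isLt
  simp only [Matrix.of_apply]
  rw [MdEnt_eq_s7 _ _ _ (by omega) (by omega), Polynomial.coeff_one_add_X_pow]

/-- For `1 ≤ k ≤ n = 2^d`: (i) for every `0 ≤ ℓ ≤ n−k`, the `k × k`
submatrix of `M_d` given by rows `ℓ,…,ℓ+k−1` and the last `k` columns is invertible;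
(ii) for every `0 ≤ s ≤ n−k`, the `k × k` submatrix of `M_d` given by the top `k`
rows and columns `s,…,s+k−1` is invertible. -/
theorem Md_submatrices_invertible (d k : ℕ) (hk1 : 1 ≤ k) (hk2 : k ≤ 2 ^ d) :
    (∀ ℓ, ∀ hl : ℓ ≤ 2 ^ d - k,
      IsUnit (Matrix.of fun a b : Fin k =>
        Md d ⟨ℓ + (a : ℕ), by have := a.isLt; omega⟩
          ⟨2 ^ d - k + (b : ℕ), by have := b.isLt; omega⟩)) ∧
    (∀ s, ∀ hs : s ≤ 2 ^ d - k,
      IsUnit (Matrix.of fun a b : Fin k =>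
        Md d ⟨(a : ℕ), by have := a.isLt; omega⟩
          ⟨s + (b : ℕ), by have := b.isLt; omega⟩)) := by
  constructor
  · intro l hl
    have h := isUnit_top d k (2 ^ d - k - l) (by omega)
    rw [Matrix.isUnit_iff_isUnit_det, ← Matrix.det_transpose,
      ← Matrix.det_submatrix_equiv_self Fin.revPerm] at h
    rw [Matrix.isUnit_iff_isUnit_det]
    convert h using 2
    ext a b
    have := a.isLt
    have := b.isLt
    simp only [Md, Matrix.of_apply, Matrix.submatrix_apply, Matrix.transpose_apply,
      Fin.revPerm_apply, Fin.val_rev]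
    rw [MdEnt_symm _ _ _ (by omega) (by omega)]
    congr 1 <;> omega
  · intro s hs
    exact isUnit_top d k s (by omega)
end
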